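/- arXiv:1803.03509 — 10 statements merged into one kernel-verified Lean document; each statement's English description precedes it below -/
import Mathlib

section
/- Let n and m be positive integers with gcd(n,m) = d. Then the intersection of the cyclotomic fields ℚ(ζ_n) and ℚ(ζ_m) (as subfields of ℂ) equals ℚ(ζ_d); that is, Q(w_n) ∩ Q(w_m) = Q(w_d). -/
open IntermediateField

/-- `w n = e^{2πi/n}`, a primitive `n`-th root of unity in `ℂ`. -/
noncomputable def w (n : ℕ) : ℂ := Complex.exp (2 * Real.pi * Complex.I / n)

/-- `φ(gcd) φ(lcm) = φ(n) φ(m)`. -/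
theorem totient_gcd_mul_totient_lcm_aux (n m : ℕ) (hn : 0 < n) :
    (n.gcd m).totient * (n.lcm m).totient = n.totient * m.totient := by
  have h1 := Nat.totient_gcd_mul_totient_mul n m
  have h2 := Nat.totient_gcd_mul_totient_mul (n.gcd m) (n.lcm m)
  have h3 : (n.gcd m).gcd (n.lcm m) = n.gcd m :=
    Nat.gcd_eq_left ((Nat.gcd_dvd_left n m).trans (Nat.dvd_lcm_left n m))
  rw [h3, Nat.gcd_mul_lcm] at h2
  exact Nat.eq_of_mul_eq_mul_right (Nat.gcd_pos_of_pos_left m hn) (h2.symm.trans h1)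

theorem adjoin_isCyclotomicExtension_aux {K L : Type*} [Field K] [Field L] [Algebra K L]
    [CharZero K] (n : ℕ) [NeZero n] (z : L) (h : IsPrimitiveRoot z n) :
    IsCyclotomicExtension {n} K K⟮z⟯ :=
  (isCyclotomicExtension_singleton_iff_eq_adjoin n K L K⟮z⟯ h).2 rfl

/-- `[AB : F] [A ∩ B : F] ≤ [A : F] [B : F]`. -/
theorem finrank_inf_mul_finrank_sup_le {F E : Type*} [Field F] [Field E] [Algebra F E]
    (A B : IntermediateField F E) :
    Module.finrank F ↥(A ⊓ B) * Module.finrank F ↥(A ⊔ B) ≤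
      Module.finrank F A * Module.finrank F B := by
  have hA : A ⊓ B ≤ A := inf_le_left
  have hB : A ⊓ B ≤ B := inf_le_right
  have hS : A ⊓ B ≤ A ⊔ B := hA.trans le_sup_left
  have h := finrank_sup_le (extendScalars hA) (extendScalars hB)
  rw [extendScalars_sup, ← relfinrank_eq_finrank_of_le, ← relfinrank_eq_finrank_of_le,
    ← relfinrank_eq_finrank_of_le] at h
  rw [← finrank_bot_mul_relfinrank hA, ← finrank_bot_mul_relfinrank hB,
    ← finrank_bot_mul_relfinrank hS]
  calc _ ≤ _ := Nat.mul_le_mul_left _ (Nat.mul_le_mul_left _ h)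
    _ = _ := by ring

theorem adjoin_inf_adjoin_aux {K L : Type*} [Field K] [Field L] [Algebra K L] [CharZero K]
    (hirr : ∀ k : ℕ, 0 < k → Irreducible (Polynomial.cyclotomic k K))
    (n m : ℕ) (hn : 0 < n) (hm : 0 < m) (x y z : L) (hx : IsPrimitiveRoot x n)
    (hy : IsPrimitiveRoot y m) (hz : IsPrimitiveRoot z (n.gcd m)) :
    K⟮x⟯ ⊓ K⟮y⟯ = K⟮z⟯ := by
  have hd : 0 < n.gcd m := Nat.gcd_pos_of_pos_left m hn
  have hl : 0 < n.lcm m := Nat.lcm_pos hn hm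
  have : NeZero n := ⟨hn.ne'⟩
  have : NeZero m := ⟨hm.ne'⟩
  have : NeZero (n.gcd m) := ⟨hd.ne'⟩
  have : NeZero (n.lcm m) := ⟨hl.ne'⟩
  have := adjoin_isCyclotomicExtension_aux (K := K) n x hx
  have := adjoin_isCyclotomicExtension_aux (K := K) m y hy
  have := adjoin_isCyclotomicExtension_aux (K := K) _ z hz
  have : IsCyclotomicExtension {n.lcm m} K ↥(K⟮x⟯ ⊔ K⟮y⟯) :=
    isCyclotomicExtension_lcm_sup K L n m _ _
  have : FiniteDimensional K K⟮x⟯ := IsCyclotomicExtension.finite_of_singleton n K _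
  have : FiniteDimensional K ↥(K⟮x⟯ ⊓ K⟮y⟯) := inferInstance
  have key := finrank_inf_mul_finrank_sup_le K⟮x⟯ K⟮y⟯
  rw [IsCyclotomicExtension.finrank K⟮x⟯ (hirr n hn),
    IsCyclotomicExtension.finrank K⟮y⟯ (hirr m hm),
    IsCyclotomicExtension.finrank ↥(K⟮x⟯ ⊔ K⟮y⟯) (hirr _ hl),
    ← totient_gcd_mul_totient_lcm_aux n m hn] at key
  symm
  apply eq_of_le_of_finrank_le
  · exact le_inf
      (isCyclotomicExtension_le_of_dvd K L (n.gcd m) n _ _ (Nat.gcd_dvd_left n m))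
      (isCyclotomicExtension_le_of_dvd K L (n.gcd m) m _ _ (Nat.gcd_dvd_right n m))
  · rw [IsCyclotomicExtension.finrank K⟮z⟯ (hirr _ hd)]
    exact Nat.le_of_mul_le_mul_right key (Nat.totient_pos.2 hl)

/-- Let `n` and `m` be positive integers with `gcd(n,m) = d`. Then
`ℚ(ζ_n) ∩ ℚ(ζ_m) = ℚ(ζ_d)` as subfields of `ℂ`. -/
theorem cyclotomic_inter (n m : ℕ) (hn : 0 < n) (hm : 0 < m) :
    ℚ⟮w n⟯ ⊓ ℚ⟮w m⟯ = ℚ⟮w (Nat.gcd n m)⟯ := by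
  have hw (k : ℕ) (hk : 0 < k) : IsPrimitiveRoot (w k) k :=
    Complex.isPrimitiveRoot_exp k hk.ne'
  exact adjoin_inf_adjoin_aux (fun k hk => Polynomial.cyclotomic.irreducible_rat hk) n m hn hm
    _ _ _ (hw n hn) (hw m hm) (hw _ (Nat.gcd_pos_of_pos_left m hn))
end

section
/- Let p be an odd prime and let w_p = e^{2πi/p}. Then the quadratic Gauss sum ∑_{j=0}^{p-1} (j/p) · w_p^j equals √p if p ≡ 1 (mod 4), and equals i·√p if p ≡ 3 (mod 4). In particular this sum, denoted √(p*), lies in ℚ(ζ_p). -/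
open IntermediateField

section helpers
open Polynomial

lemma sum_range_zmod (p : ℕ) [NeZero p] {M : Type*} [AddCommMonoid M] (f : ZMod p → M) :
    ∑ j ∈ Finset.range p, f (j : ZMod p) = ∑ x : ZMod p, f x := by
  refine Finset.sum_bij' (fun j _ => (j : ZMod p)) (fun x _ => x.val) ?_ ?_ ?_ ?_ ?_
  · intros; simp
  · intro x _; simpa using ZMod.val_lt x
  · intro j hj; exact ZMod.val_cast_of_lt (by simpa using hj)
  · intro x _; simp
  · intros; rfl

lemma sum_pow_card_sub_one (p : ℕ) [hp : Fact p.Prime] :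
    ∑ x : ZMod p, x ^ (p - 1) = -1 := by
  have h : ∀ x : ZMod p, x ^ (p - 1) = 1 - (if x = 0 then 1 else 0) := by
    intro x
    split_ifs with h
    · have := hp.out.two_le
      rw [h, zero_pow (by omega)]; simp
    · rw [ZMod.pow_card_sub_one_eq_one h]; simp
  simp only [h]
  simp

lemma sum_monic (p : ℕ) [hp : Fact p.Prime] (f : (ZMod p)[X]) (hf : f.Monic)
    (hd : f.natDegree = p - 1) : ∑ x : ZMod p, f.eval x = -1 := by
  simp only [eval_eq_sum_range]
  rw [Finset.sum_comm, hd, Finset.sum_range_succ]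
  simp only [← Finset.mul_sum]
  rw [sum_pow_card_sub_one, Finset.sum_eq_zero]
  · rw [← hd, coeff_natDegree, hf.leadingCoeff]; simp
  · intro i hi
    rw [FiniteField.sum_pow_lt_card_sub_one (ZMod p) i (by simpa using hi), mul_zero]

lemma sum_choose (p m : ℕ) [hp : Fact p.Prime] (hm : p = 2 * m + 1) :
    (m.factorial : ZMod p) * ∑ j ∈ Finset.range p,
      ((legendreSym p j : ℤ) : ZMod p) * (j.choose m : ZMod p) = -1 := by
  rw [← sum_monic p (X ^ m * descPochhammer (ZMod p) m)
    ((monic_X_pow m).mul (monic_descPochhammer _ m)) ?_, ← sum_range_zmod, Finset.mul_sum]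
  · refine Finset.sum_congr rfl fun j _ => ?_
    rw [legendreSym.eq_pow, eval_mul, descPochhammer_eval_eq_descFactorial,
      Nat.descFactorial_eq_factorial_mul_choose]
    have : p / 2 = m := by omega
    rw [this]
    simp
    ring
  · rw [(monic_X_pow m).natDegree_mul (monic_descPochhammer _ m), descPochhammer_natDegree]
    simp; omega

lemma fact_sq (p m : ℕ) [hp : Fact p.Prime] (hm : p = 2 * m + 1) :
    (m.factorial : ZMod p) ^ 2 = (-1) ^ (m + 1) := by
  have h1 := ZMod.wilsons_lemma p
  have h2 : p - 1 = m + m := by omega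
  have hp0 : (2 * m + 1 : ZMod p) = 0 := by
    have : ((2 * m + 1 : ℕ) : ZMod p) = 0 := by rw [← hm]; simp
    simpa using this
  rw [h2, ← Nat.factorial_mul_ascFactorial, Nat.ascFactorial_eq_prod_range,
    ← Finset.prod_range_reflect] at h1
  have h3 : ∏ j ∈ Finset.range m, ((m + 1 + (m - 1 - j) : ℕ) : ZMod p)
      = (-1) ^ m * (m.factorial : ZMod p) := by
    rw [← Finset.prod_range_add_one_eq_factorial, Nat.cast_prod]
    rw [← Finset.card_range m, ← Finset.prod_const, Finset.card_range, ← Finset.prod_mul_distrib]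
    refine Finset.prod_congr rfl fun j hj => ?_
    have hj' : j < m := by simpa using hj
    have : (m + 1 + (m - 1 - j) : ℕ) + (j + 1) = 2 * m + 1 := by omega
    have h4 : (((m + 1 + (m - 1 - j) : ℕ) + (j + 1) : ℕ) : ZMod p) = 0 := by
      rw [this, ← hm]; simp
    rw [Nat.cast_add] at h4
    rw [eq_neg_of_add_eq_zero_left h4]; ring
  rw [Nat.cast_mul, Nat.cast_prod, h3] at h1
  have h5 : ((-1 : ZMod p) ^ m) * (-1) ^ m = 1 := by rw [← mul_pow]; simp
  calc (m.factorial : ZMod p) ^ 2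
      = ((-1 : ZMod p) ^ m * (-1) ^ m) * (m.factorial : ZMod p) ^ 2 := by rw [h5, one_mul]
    _ = (-1 : ZMod p) ^ m * ((m.factorial : ZMod p) * ((-1) ^ m * (m.factorial : ZMod p))) := by ring
    _ = _ := by rw [h1]; ring

/-- The Gauss sum as an integer polynomial. -/
noncomputable def gPoly (p : ℕ) [Fact p.Prime] : ℤ[X] :=
  ∑ j ∈ Finset.range p, C (legendreSym p j) * X ^ j

/-- The product as an integer polynomial. -/
noncomputable def qPoly (m : ℕ) : ℤ[X] :=
  ∏ k ∈ Finset.range m, (X ^ (m * (k + 1)) * (X ^ (k + 1) - 1))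

lemma sign_eq (p m : ℕ) [hp : Fact p.Prime] (hm : p = 2 * m + 1) (hm0 : 0 < m) (s : ℤ) (z : ℂ)
    (hz : IsPrimitiveRoot z p) (h : aeval z (gPoly p) = s * aeval z (qPoly m)) :
    (s : ZMod p) = (-1) ^ m := by
  have h0 : aeval z (gPoly p - C s * qPoly m) = 0 := by simp [h]
  have hd := minpoly.isIntegrallyClosed_dvd (hz.isIntegral hp.out.pos) h0
  rw [← cyclotomic_eq_minpoly hz hp.out.pos] at hd
  have hd2 := _root_.map_dvd (mapRingHom (Int.castRingHom (ZMod p))) hd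
  simp only [coe_mapRingHom, map_cyclotomic] at hd2
  have hc : cyclotomic p (ZMod p) = (X - 1) ^ (p - 1) := by
    have h1 : cyclotomic p (ZMod p) * (X - 1) = (X - 1) ^ (p - 1) * (X - 1) := by
      rw [cyclotomic_prime_mul_X_sub_one, ← pow_succ, Nat.sub_add_cancel hp.out.one_le,
        sub_pow_char]
      simp
    exact mul_right_cancel₀ (by simpa using X_sub_C_ne_zero (1 : ZMod p)) h1
  rw [hc] at hd2
  have hd3 := _root_.map_dvd (compRingHom (X + 1 : (ZMod p)[X])) hd2
  simp only [coe_compRingHom_apply] at hd3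
  rw [pow_comp, sub_comp, X_comp, one_comp, add_sub_cancel_right, X_pow_dvd_iff] at hd3
  have hco := hd3 m (by omega)
  rw [Polynomial.map_sub, sub_comp, coeff_sub, sub_eq_zero] at hco
  have hg : (((gPoly p).map (Int.castRingHom (ZMod p))).comp (X + 1)).coeff m =
      ∑ j ∈ Finset.range p, ((legendreSym p j : ℤ) : ZMod p) * (j.choose m : ZMod p) := by
    simp only [gPoly, Polynomial.map_sum, ← coe_compRingHom_apply, map_sum, finsetSum_coeff]
    refine Finset.sum_congr rfl fun j _ => ?_
    rw [coe_compRingHom_apply, Polynomial.map_mul, map_C, Polynomial.map_pow, map_X, mul_comp,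
      C_comp, pow_comp, X_comp, coeff_C_mul, coeff_X_add_one_pow]
    rfl
  have hq : (((C s * qPoly m).map (Int.castRingHom (ZMod p))).comp (X + 1)).coeff m =
      s * (m.factorial : ZMod p) := by
    have : ((qPoly m).map (Int.castRingHom (ZMod p))).comp (X + 1) =
        (∏ k ∈ Finset.range m, ((X + 1) ^ (m * (k + 1)) *
          ∑ i ∈ Finset.range (k + 1), (X + 1) ^ i)) * X ^ m := by
      simp only [qPoly, Polynomial.map_prod, prod_comp]
      conv_rhs => rw [← Finset.card_range m, ← Finset.prod_const, Finset.card_range,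
        ← Finset.prod_mul_distrib]
      refine Finset.prod_congr rfl fun j _ => ?_
      have := geom_sum_mul (X + 1 : (ZMod p)[X]) (j + 1)
      rw [add_sub_cancel_right] at this
      rw [mul_assoc, this]
      simp
    rw [Polynomial.map_mul, mul_comp, this, map_C, C_comp, coeff_C_mul, coeff_mul_X_pow', if_pos le_rfl,
      Nat.sub_self, coeff_zero_eq_eval_zero, eval_prod]
    congr 1
    rw [← Finset.prod_range_add_one_eq_factorial, Nat.cast_prod]
    refine Finset.prod_congr rfl fun j _ => ?_
    simp [eval_finsetSum]
  rw [hg, hq] at hco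
  have h1 := sum_choose p m hm
  rw [hco] at h1
  have h2 := fact_sq p m hm
  have h3 : (s : ZMod p) * (-1) ^ (m + 1) = -1 := by rw [← h2, ← h1]; ring
  have h5 : ((-1 : ZMod p) ^ m) * (-1) ^ m = 1 := by rw [← mul_pow]; simp
  calc (s : ZMod p) = s * ((-1 : ZMod p) ^ m * (-1) ^ m) := by rw [h5, mul_one]
    _ = - (s * (-1) ^ (m + 1)) * (-1) ^ m := by ring
    _ = _ := by rw [h3]; simp

lemma w_prim (p : ℕ) [hp : Fact p.Prime] : IsPrimitiveRoot (w p) p :=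
  Complex.isPrimitiveRoot_exp p hp.out.ne_zero

lemma gauss_sq (p m : ℕ) [hp : Fact p.Prime] (hm : p = 2 * m + 1) :
    (∑ j ∈ Finset.range p, ((legendreSym p j : ℤ) : ℂ) * w p ^ j) ^ 2 = (-1) ^ m * p := by
  have hprim := AddChar.zmodChar_primitive_of_primitive_root p (w_prim p)
  have hp2 : p ≠ 2 := by omega
  have hr : ringChar (ZMod p) ≠ 2 := by rwa [ZMod.ringChar_zmod_n]
  have h := gaussSum_sq (χ := (quadraticChar (ZMod p)).ringHomComp (Int.castRingHom ℂ))
    ((MulChar.ringHomComp_ne_one_iff (RingHom.injective_int _)).mpr (quadraticChar_ne_one hr))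
    ((quadraticChar_isQuadratic (ZMod p)).comp _) hprim
  rw [gaussSum, ← sum_range_zmod] at h
  have h2 : legendreSym p (-1) = (-1) ^ m := by
    rw [legendreSym.at_neg_one hp2, ZMod.χ₄_eq_neg_one_pow (by omega)]
    congr 1; omega
  have h3 : quadraticChar (ZMod p) (-1) = (-1) ^ m := by
    rw [← h2, legendreSym]; simp
  rw [MulChar.ringHomComp_apply, h3, ZMod.card] at h
  simp only [map_pow, map_neg, map_one] at h
  rw [← h]
  congr 1
  refine Finset.sum_congr rfl fun j _ => ?_
  rw [AddChar.zmodChar_apply']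
  simp [legendreSym]

/-- The product of sines. -/
noncomputable def bProd (p m : ℕ) : ℝ :=
  ∏ k ∈ Finset.range m, (2 * Real.sin (Real.pi * (k + 1) / p))

lemma factor_eq (p m k : ℕ) [hp : Fact p.Prime] (hm : p = 2 * m + 1) :
    w p ^ (m * k) * (w p ^ k - 1) =
      (-1) ^ k * (Complex.I * ((2 * Real.sin (Real.pi * k / p) : ℝ) : ℂ)) := by
  have hp0 : (p : ℂ) ≠ 0 := by exact_mod_cast hp.out.ne_zero
  have hpm : (p : ℂ) = 2 * m + 1 := by rw [hm]; push_cast; ring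
  have h1 : (-1 : ℂ) ^ k = Complex.exp (k * (Real.pi * Complex.I)) := by
    rw [Complex.exp_nat_mul, Complex.exp_pi_mul_I]
  rw [h1, w, ← Complex.exp_nat_mul, ← Complex.exp_nat_mul]
  push_cast
  rw [Complex.sin]
  have e1 : Complex.exp (k * (2 * Real.pi * Complex.I / p)) =
     Complex.exp (Real.pi * k / p * Complex.I) * Complex.exp (Real.pi * k / p * Complex.I) := by
    rw [← Complex.exp_add]; congr 1; field_simp; ring
  have e2 : Complex.exp (k * (Real.pi * Complex.I)) =
     Complex.exp (m * k * (2 * Real.pi * Complex.I / p)) *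
      Complex.exp (Real.pi * k / p * Complex.I) := by
    rw [← Complex.exp_add]; congr 1; field_simp; rw [hpm]; ring
  have e3 : Complex.exp (Real.pi * k / p * Complex.I) *
      Complex.exp (-(Real.pi * k / p) * Complex.I) = 1 := by
    rw [← Complex.exp_add, ← Complex.exp_zero]; congr 1; ring
  rw [e1, e2]
  linear_combination (Complex.exp (m * k * (2 * Real.pi * Complex.I / p))) *
    e3 + (Complex.exp (m * k * (2 * Real.pi * Complex.I / p)) *
      Complex.exp (Real.pi * k / p * Complex.I) *
      (Complex.exp (Real.pi * k / p * Complex.I) - 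
      Complex.exp (-(Real.pi * k / p) * Complex.I))) * Complex.I_sq

lemma bProd_eq (p m : ℕ) [hp : Fact p.Prime] (hm : p = 2 * m + 1) :
    bProd p m = Real.sqrt p := by
  have hpp : (0 : ℝ) < p := by exact_mod_cast hp.out.pos
  have hpos : ∀ k : ℕ, k < 2 * m → 0 < 2 * Real.sin (Real.pi * (k + 1) / p) := by
    intro k hk
    have : Real.pi * (k + 1) / p < Real.pi := by
      rw [div_lt_iff₀ hpp]
      have : (k : ℝ) + 1 < p := by rw [hm]; exact_mod_cast (by omega)
      exact mul_lt_mul_of_pos_left this Real.pi_pos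
    have := Real.sin_pos_of_pos_of_lt_pi (by positivity) this
    positivity
  have hB : 0 < bProd p m := Finset.prod_pos fun k hk => hpos k (by
    have := Finset.mem_range.mp hk; omega)
  have hnorm : ∀ k : ℕ, k < 2 * m →
      ‖1 - w p ^ (k + 1)‖ = 2 * Real.sin (Real.pi * (k + 1) / p) := by
    intro k hk
    have h := congrArg norm (factor_eq p m (k + 1) hm)
    have hw : ‖w p‖ = 1 := (w_prim p).norm'_eq_one hp.out.ne_zero
    rw [norm_mul, norm_mul, norm_mul, norm_pow, norm_pow, hw, Complex.norm_real,
      Nat.cast_add, Nat.cast_one, Real.norm_of_nonneg (hpos k hk).le] at h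
    rw [norm_sub_rev]
    simpa using h
  have h := IsPrimitiveRoot.prod_one_sub_pow_eq_order (n := 2 * m) (μ := w p)
    (by rw [← hm]; exact w_prim p)
  have h' := congrArg norm h
  rw [norm_prod, Finset.prod_congr rfl (fun k hk => hnorm k (by simpa using hk)), two_mul,
    Finset.prod_range_add] at h'
  have h2 : ∏ x ∈ Finset.range m, (2 * Real.sin (Real.pi * (((m + x : ℕ) : ℝ) + 1) / p))
      = bProd p m := by
    rw [bProd, ← Finset.prod_range_reflect]
    refine Finset.prod_congr rfl fun j hj => ?_
    have hj' : j < m := by simpa using hj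
    rw [← Real.sin_pi_sub]
    congr 2
    have e : ((m + (m - 1 - j) : ℕ) : ℝ) + 1 = p - (j + 1) := by
      rw [eq_sub_iff_add_eq, hm]
      exact_mod_cast (by omega)
    rw [e]
    field_simp
    ring
  rw [h2] at h'
  have h3 : ‖(((2 * m : ℕ) : ℂ) + 1)‖ = p := by
    rw [hm]
    have : (((2 * m : ℕ) : ℂ) + 1) = ((2 * m + 1 : ℕ) : ℂ) := by push_cast; ring
    rw [this, Complex.norm_natCast]
  rw [← two_mul, h3] at h'
  rw [← h', ← bProd, Real.sqrt_mul_self hB.le]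

lemma qval (p m : ℕ) [hp : Fact p.Prime] (hm : p = 2 * m + 1) :
    aeval (w p) (qPoly m) =
      (∏ k ∈ Finset.range m, (-1 : ℂ) ^ (k + 1)) * (Complex.I ^ m * ((Real.sqrt p : ℝ) : ℂ)) := by
  rw [← bProd_eq p m hm, bProd, Complex.ofReal_prod]
  conv_rhs => rw [← Finset.card_range m, ← Finset.prod_const, Finset.card_range,
    ← Finset.prod_mul_distrib, ← Finset.prod_mul_distrib]
  rw [qPoly, map_prod]
  refine Finset.prod_congr rfl fun k _ => ?_
  have := factor_eq p m (k + 1) hm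
  simpa using this

lemma sign_prod (n : ℕ) :
    (-1) ^ n * (∏ k ∈ Finset.range n, (-1 : ℂ) ^ (k + 1)) * Complex.I ^ n =
      if n % 2 = 0 then 1 else Complex.I := by
  induction n using Nat.strong_induction_on with
  | _ n ih =>
    match n with
    | 0 => simp
    | 1 => simp
    | n + 2 =>
      have h := ih n (by omega)
      rw [Nat.add_mod_right, ← h, Finset.prod_range_succ, Finset.prod_range_succ]
      have h5 : ((-1 : ℂ) ^ n) * (-1) ^ n = 1 := by rw [← mul_pow]; simp
      have hI := Complex.I_sq
      generalize (∏ k ∈ Finset.range n, (-1 : ℂ) ^ (k + 1)) = P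
      simp only [pow_add, hI]
      linear_combination ((-1) ^ n * P * Complex.I ^ n) * h5

end helpers

/-- For an odd prime `p`, the quadratic Gauss sum `∑_{j=0}^{p-1} (j/p) w_p^j` equals
`√p` if `p ≡ 1 (mod 4)` and `i√p` if `p ≡ 3 (mod 4)`; in particular it lies in `ℚ(ζ_p)`. -/
theorem gauss_sum_eq (p : ℕ) [Fact p.Prime] (hp2 : p ≠ 2) :
    (∑ j ∈ Finset.range p, ((legendreSym p j : ℤ) : ℂ) * w p ^ j =
        if p % 4 = 1 then ((Real.sqrt p : ℝ) : ℂ) else Complex.I * ((Real.sqrt p : ℝ) : ℂ)) ∧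
    (∑ j ∈ Finset.range p, ((legendreSym p j : ℤ) : ℂ) * w p ^ j) ∈ ℚ⟮w p⟯ := by
  have hp : p.Prime := Fact.out
  refine ⟨?_, ?_⟩
  · obtain ⟨m, hm⟩ := hp.odd_of_ne_two hp2
    have hm0 : 0 < m := by have := hp.two_le; omega
    have hsq := gauss_sq p m hm
    have hG : Polynomial.aeval (w p) (gPoly p) =
        ∑ j ∈ Finset.range p, ((legendreSym p j : ℤ) : ℂ) * w p ^ j := by
      simp [gPoly]
    have hq := qval p m hm
    have hs : ((Real.sqrt p : ℝ) : ℂ) ^ 2 = p := by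
      rw [← Complex.ofReal_pow, Real.sq_sqrt (Nat.cast_nonneg p)]; simp
    have hP : (∏ k ∈ Finset.range m, (-1 : ℂ) ^ (k + 1)) ^ 2 = 1 := by
      rw [← Finset.prod_pow]
      refine Finset.prod_eq_one fun k _ => ?_
      rw [← pow_mul, mul_comm, pow_mul]; simp
    have hq2 : (Polynomial.aeval (w p) (qPoly m)) ^ 2 = (-1) ^ m * (p : ℂ) := by
      rw [hq, mul_pow, mul_pow, hP, hs, ← pow_mul, mul_comm m 2, pow_mul, Complex.I_sq, one_mul]
    have key : ∃ s : ℤ, (s = 1 ∨ s = -1) ∧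
        Polynomial.aeval (w p) (gPoly p) = s * Polynomial.aeval (w p) (qPoly m) := by
      rw [← hq2, ← hG] at hsq
      rcases sq_eq_sq_iff_eq_or_eq_neg.mp hsq with h | h
      · exact ⟨1, Or.inl rfl, by simp [h]⟩
      · exact ⟨-1, Or.inr rfl, by simp [h]⟩
    obtain ⟨s, hs1, hs2⟩ := key
    have hsgn := sign_eq p m hm hm0 s (w p) (w_prim p) hs2
    have : Fact (2 < p) := ⟨by omega⟩
    have hne : (-1 : ZMod p) ≠ 1 := ZMod.neg_one_ne_one
    have hs3 : s = (-1) ^ m := by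
      rcases Nat.even_or_odd m with he | he
      · rw [he.neg_one_pow] at hsgn ⊢
        rcases hs1 with h | h
        · exact h
        · rw [h] at hsgn
          exact absurd (by simpa using hsgn) hne
      · rw [he.neg_one_pow] at hsgn ⊢
        rcases hs1 with h | h
        · rw [h] at hsgn
          exact absurd (by simpa using hsgn.symm) hne
        · exact h
    rw [← hG, hs2, hq, hs3]
    have hsp := sign_prod m
    push_cast
    rw [← mul_assoc, ← mul_assoc, hsp]
    by_cases h4 : p % 4 = 1
    · rw [if_pos h4, if_pos (by omega), one_mul]
    · rw [if_neg h4, if_neg (by omega)]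
  · refine sum_mem fun j _ => mul_mem (intCast_mem _ _) (pow_mem (mem_adjoin_simple_self ℚ _) _)
end

section
/- Let p be a prime with p ≡ 3 (mod 4) and let n be a positive integer. Then √p ∈ ℚ(ζ_n) if and only if 4p divides n. -/
open IntermediateField

theorem w_prim_s4 (n : ℕ) (hn : 0 < n) : IsPrimitiveRoot (w n) n :=
  Complex.isPrimitiveRoot_exp n hn.ne'

theorem w_cyc (n : ℕ) (hn : 0 < n) : IsCyclotomicExtension {n} ℚ ℚ⟮w n⟯ := by
  have : NeZero n := ⟨hn.ne'⟩
  change IsCyclotomicExtension {n} ℚ (IntermediateField.adjoin ℚ {w n}).toSubalgebra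
  rw [IntermediateField.adjoin_simple_toSubalgebra_of_isAlgebraic
    (((w_prim_s4 n hn).isIntegral hn).tower_top.isAlgebraic)]
  exact (w_prim_s4 n hn).adjoin_isCyclotomicExtension ℚ

theorem root_mem (n k : ℕ) (hn : 0 < n) (hk : k ∣ n) (z : ℂ) (hz : z ^ k = 1) :
    z ∈ ℚ⟮w n⟯ := by
  have : NeZero n := ⟨hn.ne'⟩
  obtain ⟨i, -, hi⟩ := (w_prim_s4 n hn).eq_pow_of_pow_eq_one
    (show z ^ n = 1 by obtain ⟨c, rfl⟩ := hk; rw [pow_mul, hz, one_pow])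
  rw [← hi]
  exact pow_mem (mem_adjoin_simple_self ℚ _) i

theorem I_sqrt_mem (p n : ℕ) (hp : p.Prime) (hp3 : p % 4 = 3) (hn : 0 < n) (h : p ∣ n) :
    Complex.I * ((Real.sqrt p : ℝ) : ℂ) ∈ ℚ⟮w n⟯ := by
  have : Fact p.Prime := ⟨hp⟩
  have hc : ringChar (ZMod p) ≠ 2 := by
    rw [ZMod.ringChar_zmod_n]; rintro rfl; simp at hp3
  set χ : MulChar (ZMod p) ℂ := (quadraticChar (ZMod p)).ringHomComp (Int.castRingHom ℂ) with hχ
  have hinj : Function.Injective (Int.castRingHom ℂ) := RingHom.injective_int _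
  have hsq := gaussSum_sq (χ := χ)
    ((MulChar.ringHomComp_ne_one_iff hinj).mpr (quadraticChar_ne_one hc))
    ((quadraticChar_isQuadratic (ZMod p)).comp _) (ZMod.isPrimitive_stdAddChar p)
  have hm1 : χ (-1) = -1 := by
    have : quadraticChar (ZMod p) (-1) = -1 := by
      rw [quadraticChar_neg_one_iff_not_isSquare, FiniteField.isSquare_neg_one_iff, ZMod.card]
      simpa using hp3
    simp [hχ, MulChar.ringHomComp_apply, this]
  rw [hm1, ZMod.card] at hsq
  have hg : gaussSum χ (ZMod.stdAddChar (N := p)) ∈ ℚ⟮w n⟯ := by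
    unfold gaussSum
    refine sum_mem fun a _ => mul_mem ?_ ?_
    · rw [hχ, MulChar.ringHomComp_apply]
      exact intCast_mem _ _
    · apply root_mem n p hn h
      rw [← AddChar.map_nsmul_eq_pow]
      simp
  have h2 : (Complex.I * ((Real.sqrt p : ℝ) : ℂ)) ^ 2 = -1 * (p : ℂ) := by
    rw [mul_pow, Complex.I_sq, ← Complex.ofReal_pow, Real.sq_sqrt (Nat.cast_nonneg p)]
    simp
  rcases sq_eq_sq_iff_eq_or_eq_neg.mp (h2.trans hsq.symm) with h | h
  · rw [h]; exact hg
  · rw [h]; exact neg_mem hg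

theorem dvd_of_sq (p n : ℕ) (hp : p.Prime) (hn : 0 < n) (K : Type*) [Field K] [NumberField K]
    [IsCyclotomicExtension {n} ℚ K] (x : K) (hx : x ^ 2 = p) : p ∣ n := by
  by_contra hpn
  have : Fact p.Prime := ⟨hp⟩
  have : NeZero n := ⟨hn.ne'⟩
  have hint : IsIntegral ℤ x := by
    apply IsIntegral.of_pow (n := 2) (by norm_num)
    rw [hx]; simpa using (isIntegral_algebraMap (R := ℤ) (A := K) (x := (p : ℤ)))
  let y : NumberField.RingOfIntegers K := ⟨x, hint⟩
  have hy : y ^ 2 = (p : NumberField.RingOfIntegers K) := by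
    apply NumberField.RingOfIntegers.ext
    have h1 : algebraMap (NumberField.RingOfIntegers K) K (y ^ 2) =
        algebraMap (NumberField.RingOfIntegers K) K p := by
      rw [map_pow, map_natCast]; exact hx
    exact h1
  have hpz : Prime (p : ℤ) := Nat.prime_iff_prime_int.mp hp
  have : (Ideal.span {(p : ℤ)}).IsPrime := (Ideal.span_singleton_prime hpz.ne_zero).mpr hpz
  obtain ⟨P, hP, hPo⟩ := Ideal.exists_ideal_over_prime_of_isIntegral_of_isDomain
    (S := NumberField.RingOfIntegers K) (Ideal.span {(p : ℤ)}) (by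
      rw [(RingHom.injective_iff_ker_eq_bot _).mp
        (FaithfulSMul.algebraMap_injective ℤ (NumberField.RingOfIntegers K))]
      exact bot_le)
  have : P.LiesOver (Ideal.span {(p : ℤ)}) := ⟨hPo.symm⟩
  have h1 := IsCyclotomicExtension.Rat.ramificationIdx_eq_of_not_dvd (m := n) p K P hpn
  rw [← Ideal.ramificationIdx'_eq_ramificationIdx (Ideal.span {(p : ℤ)}) P
    (by simpa using hpz.ne_zero)] at h1
  have hle : Ideal.map (algebraMap ℤ (NumberField.RingOfIntegers K)) (Ideal.span {(p : ℤ)}) ≤ P :=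
    Ideal.map_le_iff_le_comap.mpr hPo.ge
  refine (Ideal.ramificationIdx'_ne_one_iff hle).mpr ?_ h1
  have hpP : (p : NumberField.RingOfIntegers K) ∈ P := by
    apply hle
    simpa using Ideal.mem_map_of_mem (algebraMap ℤ (NumberField.RingOfIntegers K))
      (Ideal.mem_span_singleton_self (p : ℤ))
  have hyP : y ∈ P := hP.mem_of_pow_mem 2 (hy ▸ hpP)
  rw [Ideal.map_span, Set.image_singleton, Ideal.span_singleton_le_iff_mem]
  simpa [← hy] using Ideal.pow_mem_pow hyP 2

theorem four_dvd (n : ℕ) (hn : 0 < n) (h : Complex.I ∈ ℚ⟮w n⟯) : 4 ∣ n := by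
  have : NeZero n := ⟨hn.ne'⟩
  have := w_cyc n hn
  have : NumberField ℚ⟮w n⟯ := IsCyclotomicExtension.numberField {n} ℚ _
  have hI : IsPrimitiveRoot (⟨Complex.I, h⟩ : ℚ⟮w n⟯) 4 := by
    apply IsPrimitiveRoot.of_map_of_injective (f := algebraMap ℚ⟮w n⟯ ℂ) _
      (FaithfulSMul.algebraMap_injective _ _)
    exact Complex.isPrimitiveRoot_I
  have h4 := NumberField.Units.dvd_torsionOrder_of_isPrimitiveRoot hI
  rw [IsCyclotomicExtension.Rat.torsionOrder_eq (n := n)] at h4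
  split_ifs at h4 with he
  · exact h4
  · rw [Nat.not_even_iff] at he
    omega

/-- Let `p ≡ 3 (mod 4)` be a prime and `n` a positive integer. Then
`√p ∈ ℚ(ζ_n)` if and only if `4p ∣ n`. -/
theorem sqrt_mem_cyclotomic_iff_three_mod_four (p n : ℕ) (hp : p.Prime) (hp3 : p % 4 = 3)
    (hn : 0 < n) :
    ((Real.sqrt p : ℝ) : ℂ) ∈ ℚ⟮w n⟯ ↔ 4 * p ∣ n := by
  constructor
  · intro h
    have := w_cyc n hn
    have : NumberField ℚ⟮w n⟯ := IsCyclotomicExtension.numberField {n} ℚ _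
    have hpn : p ∣ n := by
      apply dvd_of_sq p n hp hn ℚ⟮w n⟯ ⟨_, h⟩
      apply Subtype.ext
      push_cast
      rw [← Complex.ofReal_pow, Real.sq_sqrt (Nat.cast_nonneg p)]
      simp
    have h0 : ((Real.sqrt p : ℝ) : ℂ) ≠ 0 := by
      have : 0 < Real.sqrt p := Real.sqrt_pos.mpr (by exact_mod_cast hp.pos)
      exact_mod_cast this.ne'
    have h4 : 4 ∣ n := by
      apply four_dvd n hn
      have := div_mem (I_sqrt_mem p n hp hp3 hn hpn) h
      rwa [mul_div_cancel_right₀ _ h0] at this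
    refine Nat.Coprime.mul_dvd_of_dvd_of_dvd ?_ h4 hpn
    refine Nat.Coprime.symm ((Nat.Prime.coprime_iff_not_dvd hp).mpr fun hd => ?_)
    have := Nat.le_of_dvd (by norm_num) hd
    have : p = 3 := by omega
    subst this
    omega
  · intro h
    have hI : Complex.I ∈ ℚ⟮w n⟯ :=
      root_mem n 4 hn (dvd_of_mul_right_dvd h) _ Complex.I_pow_four
    have := neg_mem (mul_mem hI (I_sqrt_mem p n hp hp3 hn (dvd_of_mul_left_dvd h)))
    rwa [← mul_assoc, Complex.I_mul_I, neg_one_mul, neg_neg] at this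
end

section
/- Let p be a prime with p ≡ 1 (mod 4) and let n be a positive integer divisible by p. Let σ be an element of the Galois group Gal(ℚ(ζ_n)/ℚ), determined by σ(w_n) = w_n^k for some integer k with 1 ≤ k ≤ n and gcd(k,n) = 1. If the Legendre symbol (k/p) = 1 then σ(√p) = √p, and if (k/p) = -1 then σ(√p) = -√p. -/
open IntermediateField

/-- Let `p ≡ 1 (mod 4)` be a prime and `n` a positive integer divisible by `p`.
Let `σ ∈ Gal(ℚ(ζ_n)/ℚ)` with `σ(w_n) = w_n^k`, where `1 ≤ k ≤ n` and `gcd(k,n) = 1`.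
If `(k/p) = 1` then `σ(√p) = √p`, and if `(k/p) = -1` then `σ(√p) = -√p`. -/
theorem galois_action_on_sqrt_one_mod_four (p n k : ℕ) [Fact p.Prime] (hp1 : p % 4 = 1)
    (hn : 0 < n) (hpn : p ∣ n) (hk1 : 1 ≤ k) (hkn : k ≤ n) (hk : Nat.gcd k n = 1)
    (σ : ℚ⟮w n⟯ ≃ₐ[ℚ] ℚ⟮w n⟯)
    (hσ : (σ ⟨w n, IntermediateField.mem_adjoin_simple_self ℚ (w n)⟩ : ℂ) = w n ^ k) :
    ∀ x : ℚ⟮w n⟯, (x : ℂ) = ((Real.sqrt p : ℝ) : ℂ) →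
      (legendreSym p k = 1 → (σ x : ℂ) = ((Real.sqrt p : ℝ) : ℂ)) ∧
      (legendreSym p k = -1 → (σ x : ℂ) = -((Real.sqrt p : ℝ) : ℂ)) := by
  have hp : p.Prime := Fact.out
  have hp2 : p ≠ 2 := by rintro rfl; omega
  have hF : ringChar (ZMod p) ≠ 2 := (ZMod.ringChar_zmod_n p).substr hp2
  set z : ℚ⟮w n⟯ := ⟨w n, IntermediateField.mem_adjoin_simple_self ℚ (w n)⟩ with hz
  have hσz : σ z = z ^ k := Subtype.ext (by rw [hσ]; rfl)
  have hwprim : IsPrimitiveRoot (w n) n := Complex.isPrimitiveRoot_exp n hn.ne'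
  have hzprim : IsPrimitiveRoot z n :=
    IsPrimitiveRoot.of_map_of_injective (f := algebraMap ℚ⟮w n⟯ ℂ) hwprim
      (algebraMap ℚ⟮w n⟯ ℂ).injective
  obtain ⟨m, hm⟩ := hpn
  have hζ : IsPrimitiveRoot (z ^ m) p := hzprim.pow hn (by rw [hm, mul_comm])
  set ψ : AddChar (ZMod p) ℚ⟮w n⟯ :=
    AddChar.zmodChar p ((IsPrimitiveRoot.iff_def _ p).mp hζ).left with hψ
  have hψp : ψ.IsPrimitive := AddChar.zmodChar_primitive_of_primitive_root p hζ
  set χ : MulChar (ZMod p) ℚ⟮w n⟯ :=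
    (quadraticChar (ZMod p)).ringHomComp (Int.castRingHom ℚ⟮w n⟯) with hχ
  have hχ1 : χ ≠ 1 :=
    (MulChar.ringHomComp_ne_one_iff (RingHom.injective_int _)).mpr (quadraticChar_ne_one hF)
  have hχ2 : χ.IsQuadratic := (quadraticChar_isQuadratic (ZMod p)).comp _
  have hsq := gaussSum_sq hχ1 hχ2 hψp
  have hneg : χ (-1) = 1 := by
    rw [hχ, MulChar.ringHomComp_apply, quadraticChar_neg_one hF, ZMod.card,
      ZMod.χ₄_nat_one_mod_four hp1]
    simp
  rw [hneg, one_mul, ZMod.card] at hsq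
  have hkp : Nat.Coprime k p := Nat.Coprime.coprime_dvd_right ⟨m, hm⟩ hk
  have hσg : σ (gaussSum χ ψ) = gaussSum χ (ψ.mulShift (ZMod.unitOfCoprime k hkp : ZMod p)) := by
    simp only [gaussSum, map_sum, map_mul]
    refine Finset.sum_congr rfl fun a _ => ?_
    congr 1
    · simp [hχ]
    · rw [AddChar.mulShift_apply, ZMod.coe_unitOfCoprime, ← nsmul_eq_mul,
        AddChar.map_nsmul_eq_pow, hψ, AddChar.zmodChar_apply, map_pow, map_pow, hσz]
      ring
  have hshift := gaussSum_mulShift χ ψ (ZMod.unitOfCoprime k hkp)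
  rw [← hσg] at hshift
  have hχk : χ (ZMod.unitOfCoprime k hkp : ZMod p) = ((legendreSym p k : ℤ) : ℚ⟮w n⟯) := by
    simp [hχ, legendreSym]
  rw [hχk] at hshift
  intro x hx
  have hx2 : x ^ 2 = (p : ℚ⟮w n⟯) := by
    apply Subtype.ext
    push_cast
    rw [hx, ← Complex.ofReal_pow, Real.sq_sqrt (Nat.cast_nonneg p)]
    simp
  have hxs : ((legendreSym p k : ℤ) : ℚ⟮w n⟯) * σ x = x := by
    rcases sq_eq_sq_iff_eq_or_eq_neg.mp (hx2.trans hsq.symm) with h | h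
    · rw [h]; exact hshift
    · rw [h, map_neg, mul_neg, hshift]
  constructor
  · intro h
    rw [h] at hxs
    rw [← hx, ← congrArg Subtype.val hxs]
    simp
  · intro h
    rw [h] at hxs
    rw [← hx, ← congrArg Subtype.val hxs]
    simp
end

section
/- Let p be a prime with p ≡ 3 (mod 4) and let n be a positive integer divisible by 4p. Let σ be an element of the Galois group Gal(ℚ(ζ_n)/ℚ), determined by σ(w_n) = w_n^k for some integer k with 1 ≤ k ≤ n and gcd(k,n) = 1 (note k is odd since n is even). If ((-1)^{(k-1)/2} · k / p) = 1 then σ(√p) = √p, and if ((-1)^{(k-1)/2} · k / p) = -1 then σ(√p) = -√p. -/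
open IntermediateField

/-- Let `p ≡ 3 (mod 4)` be a prime and `n` a positive integer divisible by `4p`.
Let `σ ∈ Gal(ℚ(ζ_n)/ℚ)` with `σ(w_n) = w_n^k`, where `1 ≤ k ≤ n` and `gcd(k,n) = 1`.
If `((-1)^{(k-1)/2}·k / p) = 1` then `σ(√p) = √p`, and if
`((-1)^{(k-1)/2}·k / p) = -1` then `σ(√p) = -√p`. -/
theorem galois_action_on_sqrt_three_mod_four (p n k : ℕ) [Fact p.Prime] (hp3 : p % 4 = 3)
    (hn : 0 < n) (hpn : 4 * p ∣ n) (hk1 : 1 ≤ k) (hkn : k ≤ n) (hk : Nat.gcd k n = 1)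
    (σ : ℚ⟮w n⟯ ≃ₐ[ℚ] ℚ⟮w n⟯)
    (hσ : (σ ⟨w n, IntermediateField.mem_adjoin_simple_self ℚ (w n)⟩ : ℂ) = w n ^ k) :
    ∀ x : ℚ⟮w n⟯, (x : ℂ) = ((Real.sqrt p : ℝ) : ℂ) →
      (legendreSym p ((-1) ^ ((k - 1) / 2) * (k : ℤ)) = 1 →
        (σ x : ℂ) = ((Real.sqrt p : ℝ) : ℂ)) ∧
      (legendreSym p ((-1) ^ ((k - 1) / 2) * (k : ℤ)) = -1 →
        (σ x : ℂ) = -((Real.sqrt p : ℝ) : ℂ)) := by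
  intro x hx
  have hp : p.Prime := Fact.out
  have hp0 : p ≠ 0 := hp.ne_zero
  have hp2 : p ≠ 2 := by rintro rfl; omega
  obtain ⟨m, hm⟩ : p ∣ n := (Dvd.intro_left 4 rfl).trans hpn
  obtain ⟨l, hl⟩ : 4 ∣ n := (Dvd.intro p rfl).trans hpn
  set ζ : ℚ⟮w n⟯ := ⟨w n, IntermediateField.mem_adjoin_simple_self ℚ (w n)⟩ with hζdef
  have hσζ : σ ζ = ζ ^ k := Subtype.ext (by rw [hσ]; rfl)
  have hζ : IsPrimitiveRoot ζ n := by
    have h := Complex.isPrimitiveRoot_exp n hn.ne'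
    have h2 : IsPrimitiveRoot (algebraMap ℚ⟮w n⟯ ℂ ζ) n := h
    exact IsPrimitiveRoot.of_map_of_injective h2 (algebraMap ℚ⟮w n⟯ ℂ).injective
  have hζp : IsPrimitiveRoot (ζ ^ m) p := hζ.pow hn (by rw [hm]; ring)
  have hζ4 : IsPrimitiveRoot (ζ ^ l) 4 := hζ.pow hn (by rw [hl]; ring)
  have hi2 : (ζ ^ l) ^ 2 = -1 := by
    have : IsPrimitiveRoot ((ζ ^ l) ^ 2) 2 := hζ4.pow (by norm_num) (by norm_num)
    exact this.eq_neg_one_of_two_right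
  have hkodd : k % 2 = 1 := by
    by_contra h
    have h1 : 2 ∣ k := by omega
    have h2 : 2 ∣ n := by omega
    have := Nat.dvd_gcd h1 h2
    rw [hk] at this
    omega
  have hσi : σ (ζ ^ l) = (-1) ^ ((k - 1) / 2) * ζ ^ l := by
    rw [map_pow, hσζ, ← hi2, ← pow_mul, ← pow_mul, ← pow_mul, ← pow_add]
    congr 1
    obtain ⟨j, rfl⟩ : ∃ j, k = 2 * j + 1 := ⟨k / 2, by omega⟩
    rw [show (2 * j + 1 - 1) / 2 = j by omega]
    ring
  have hpk : ¬ p ∣ k := fun h => by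
    have := Nat.dvd_gcd h (Dvd.intro m hm.symm)
    rw [hk] at this
    exact hp.one_lt.ne' (Nat.dvd_one.mp this)
  have hk0 : (k : ZMod p) ≠ 0 := by rwa [Ne, ZMod.natCast_eq_zero_iff]
  set χ : MulChar (ZMod p) ℚ⟮w n⟯ :=
    (quadraticChar (ZMod p)).ringHomComp (Int.castRingHom ℚ⟮w n⟯) with hχ
  have hrc : ringChar (ZMod p) ≠ 2 := by rwa [ZMod.ringChar_zmod_n]
  have hχ2 : χ.IsQuadratic := (quadraticChar_isQuadratic (ZMod p)).comp _
  have hχ1 : χ ≠ 1 :=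
    (MulChar.ringHomComp_ne_one_iff (RingHom.injective_int _)).mpr (quadraticChar_ne_one hrc)
  haveI : NeZero p := ⟨hp0⟩
  set ψ : AddChar (ZMod p) ℚ⟮w n⟯ := AddChar.zmodChar p hζp.pow_eq_one with hψ
  have hψp : ψ.IsPrimitive := AddChar.zmodChar_primitive_of_primitive_root p hζp
  have hχval : ∀ a : ℤ, χ (a : ZMod p) = ((legendreSym p a : ℤ) : ℚ⟮w n⟯) := fun a => rfl
  have hneg : legendreSym p (-1) = -1 := by
    rw [legendreSym.at_neg_one hp2, ZMod.χ₄_nat_three_mod_four hp3]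
  have hg2 : gaussSum χ ψ ^ 2 = -p := by
    rw [gaussSum_sq hχ1 hχ2 hψp, ZMod.card]
    have := hχval (-1)
    rw [hneg] at this
    push_cast at this
    rw [this]; ring
  have hσψ : ∀ a, σ (ψ a) = AddChar.mulShift ψ (k : ZMod p) a := by
    intro a
    rw [AddChar.mulShift_apply, ← nsmul_eq_mul, AddChar.map_nsmul_eq_pow, hψ,
      AddChar.zmodChar_apply, map_pow, map_pow, hσζ]
    ring
  have hσχ : ∀ a, σ (χ a) = χ a := fun a => by
    simp [hχ, MulChar.ringHomComp_apply]
  have hσg0 : σ (gaussSum χ ψ) = gaussSum χ (AddChar.mulShift ψ (k : ZMod p)) := by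
    simp only [gaussSum, map_sum, map_mul, hσψ, hσχ]
  have hkχ := hχval k
  have hksq : χ (k : ZMod p) * χ (k : ZMod p) = 1 := by
    have h := legendreSym.sq_one p (a := (k : ℤ)) (by exact_mod_cast hk0)
    rw [Int.cast_natCast] at hkχ
    rw [hkχ]
    exact_mod_cast (by rw [← sq]; exact h)
  have hσg : σ (gaussSum χ ψ) = χ (k : ZMod p) * gaussSum χ ψ := by
    have h := gaussSum_mulShift χ ψ (Units.mk0 (k : ZMod p) hk0)
    rw [Units.val_mk0] at h
    rw [hσg0, ← h, ← mul_assoc, hksq, one_mul]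
  have hleg : ((legendreSym p ((-1) ^ ((k - 1) / 2) * (k : ℤ)) : ℤ) : ℚ⟮w n⟯)
      = (-1) ^ ((k - 1) / 2) * χ (k : ZMod p) := by
    rw [legendreSym.mul, ← legendreSym.hom_apply, map_pow, legendreSym.hom_apply, hneg]
    rw [Int.cast_natCast] at hkχ
    rw [hkχ]
    push_cast
    rfl
  set L := legendreSym p ((-1) ^ ((k - 1) / 2) * (k : ℤ)) with hL
  have hx2 : x ^ 2 = p := by
    apply Subtype.ext
    have : (x : ℂ) ^ 2 = p := by
      rw [hx, ← Complex.ofReal_pow, Real.sq_sqrt (Nat.cast_nonneg p)]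
      simp
    simpa using this
  have hy2 : x ^ 2 = (ζ ^ l * gaussSum χ ψ) ^ 2 := by
    rw [mul_pow, hi2, hg2, hx2]; ring
  have hσy : σ (ζ ^ l * gaussSum χ ψ) = (L : ℚ⟮w n⟯) * (ζ ^ l * gaussSum χ ψ) := by
    rw [map_mul, hσi, hσg, hleg]; ring
  have hσx : σ x = (L : ℚ⟮w n⟯) * x := by
    rcases sq_eq_sq_iff_eq_or_eq_neg.mp hy2 with h | h
    · rw [h, hσy]
    · rw [h, map_neg, hσy]; ring
  constructor
  · intro h
    rw [hσx, h, ← hx]; simp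
  · intro h
    rw [hσx, h, ← hx]; simp
end

section
/- Let p be a prime, r ≥ 1, q = p^r, and g ≥ 1. Let ζ_1, …, ζ_{2g} ∈ ℂ be roots of unity such that the polynomial ∏_{i=1}^{2g}(X - √q·ζ_i) has rational coefficients, let s be the least positive integer with ζ_i^s = 1 for all i (the period), and set S_k = -q^{k/2}·∑_{i=1}^{2g} ζ_i^k for k ≥ 1. Let n be a positive integer, m = gcd(n,s), and suppose m·r is even. Then S_n = q^{(n-m)/2}·S_m (both sides being rational numbers, with q^{(n-m)/2} = p^{r(n-m)/2} an integer since r(n-m) is even). -/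
open Polynomial in
theorem aux_psum_rat {N : ℕ} (α : Fin N → ℂ)
    (h : ∀ j : ℕ, (∏ i, (X - C (α i))).coeff j ∈ (algebraMap ℚ ℂ).fieldRange) (k : ℕ) :
    ∑ i, α i ^ k ∈ (algebraMap ℚ ℂ).fieldRange := by
  set K := (algebraMap ℚ ℂ).fieldRange with hK
  have hneg : ∀ j : ℕ, ((-1 : ℂ)) ^ j ∈ K := fun j => pow_mem (neg_mem (one_mem K)) j
  have hes : ∀ j, MvPolynomial.aeval α (MvPolynomial.esymm (Fin N) ℚ j) ∈ K := by
    intro j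
    rw [MvPolynomial.aeval_esymm_eq_multiset_esymm]
    have hc : Multiset.card ((Finset.univ : Finset (Fin N)).val.map α) = N := by simp
    by_cases hj : j ≤ N
    · have h1 := Multiset.prod_X_sub_C_coeff ((Finset.univ : Finset (Fin N)).val.map α)
        (k := N - j) (by rw [hc]; omega)
      rw [hc, Nat.sub_sub_self hj, Multiset.map_map] at h1
      have h2 := h (N - j)
      have h3 : (∏ i, (X - C (α i))).coeff (N - j) =
        (-1) ^ j * ((Finset.univ : Finset (Fin N)).val.map α).esymm j := h1
      rw [h3] at h2
      have h4 := mul_mem (hneg j) h2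
      rwa [← mul_assoc, ← mul_pow, neg_one_mul, neg_neg, one_pow, one_mul] at h4
    · rw [Multiset.esymm, Multiset.powersetCard_eq_empty _ (by rw [hc]; omega)]
      simp
  have key : ∀ k, MvPolynomial.aeval α (MvPolynomial.psum (Fin N) ℚ k) ∈ K := by
    intro k
    induction k using Nat.strong_induction_on with
    | _ k ih =>
      rcases Nat.eq_zero_or_pos k with rfl | hk
      · simp
      · rw [MvPolynomial.psum_eq_mul_esymm_sub_sum _ _ k hk]
        simp only [map_sub, map_mul, map_sum, map_pow, map_neg, map_one, map_natCast]
        refine sub_mem (mul_mem (mul_mem (hneg _) (natCast_mem K k)) (hes k)) (sum_mem ?_)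
        rintro ⟨a, b⟩ hab
        simp only [Finset.mem_filter, Set.mem_Ioo] at hab
        have hab1 : a + b = k := Finset.HasAntidiagonal.mem_antidiagonal.1 hab.1
        exact mul_mem (mul_mem (hneg _) (hes _)) (ih b (by omega))
  simpa [MvPolynomial.psum] using key k

open Polynomial in
theorem aux_galois {M : ℕ} (η : Fin M → ℂ) (N t : ℕ) (hN : 0 < N) (ht : t.Coprime N)
    (hη : ∀ i, η i ^ N = 1) (hT : ∑ i, η i ∈ (algebraMap ℚ ℂ).fieldRange) :
    ∑ i, η i ^ t = ∑ i, η i := by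
  obtain ⟨T, hT⟩ := hT
  haveI : NeZero N := ⟨hN.ne'⟩
  have hξ := Complex.isPrimitiveRoot_exp N hN.ne'
  set ξ := Complex.exp (2 * Real.pi * Complex.I / N)
  choose a _ ha using fun i => hξ.eq_pow_of_pow_eq_one (hη i)
  let F : ℚ[X] := ∑ i, X ^ (a i) - C T
  have h1 : aeval ξ F = 0 := by
    simp only [F, map_sub, map_sum, map_pow, aeval_X, aeval_C, ha]
    rw [hT, sub_self]
  have h2 : minpoly ℚ ξ = minpoly ℚ (ξ ^ t) := by
    rw [← cyclotomic_eq_minpoly_rat hξ hN,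
      ← cyclotomic_eq_minpoly_rat (hξ.pow_of_coprime t ht) hN]
  have h3 : aeval (ξ ^ t) F = 0 := by
    rw [← minpoly.dvd_iff, ← h2, minpoly.dvd_iff, h1]
  simp only [F, map_sub, map_sum, map_pow, aeval_X, aeval_C] at h3
  rw [← hT, ← sub_eq_zero, ← h3]
  congr 1
  refine Finset.sum_congr rfl fun i _ => ?_
  rw [← ha i, pow_right_comm]


/-- Reduction theorem for supersingular curves, case `m·r` even: with `q = p^r`,
`ζ_1, …, ζ_{2g}` roots of unity of period `s` such that `∏ (X - √q·ζ_i)` has rational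
coefficients, `S_k = -q^{k/2}·∑ ζ_i^k`, `n > 0`, `m = gcd(n,s)` and `m·r` even, we have
`S_n = q^{(n-m)/2}·S_m`. -/
theorem reduction_even (p r g : ℕ) (hp : p.Prime) (hr : 1 ≤ r) (hg : 1 ≤ g)
    (ζ : Fin (2 * g) → ℂ) (s : ℕ) (hs : 0 < s) (hζs : ∀ i, ζ i ^ s = 1)
    (hleast : ∀ s' : ℕ, 0 < s' → (∀ i, ζ i ^ s' = 1) → s ≤ s')
    (hrat : ∀ j : ℕ, ∃ c : ℚ,
      (∏ i, (Polynomial.X -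
        Polynomial.C (((Real.sqrt ((p : ℝ) ^ r) : ℝ) : ℂ) * ζ i))).coeff j = (c : ℂ))
    (S : ℕ → ℂ)
    (hS : ∀ k : ℕ, S k = -((Real.sqrt ((p : ℝ) ^ r) : ℝ) : ℂ) ^ k * ∑ i, ζ i ^ k)
    (n : ℕ) (hn : 0 < n) (m : ℕ) (hm : m = Nat.gcd n s) (heven : Even (m * r)) :
    S n = ((Real.sqrt ((p : ℝ) ^ r) : ℝ) : ℂ) ^ (n - m) * S m := by
  subst hm
  set m := n.gcd s with hm
  have hmpos : 0 < m := Nat.gcd_pos_of_pos_left _ hn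
  obtain ⟨t, ht⟩ : m ∣ n := Nat.gcd_dvd_left n s
  obtain ⟨N, hN⟩ : m ∣ s := Nat.gcd_dvd_right n s
  have hNpos : 0 < N := Nat.pos_of_ne_zero (by rintro rfl; simp at hN; omega)
  have hcop : t.Coprime N := by
    have h := Nat.coprime_div_gcd_div_gcd (m := n) (n := s) hmpos
    rw [← hm] at h
    have e1 : n / m = t := Nat.div_eq_of_eq_mul_right hmpos ht
    have e2 : s / m = N := Nat.div_eq_of_eq_mul_right hmpos hN
    rwa [e1, e2] at h
  have hmn : m ≤ n := Nat.le_of_dvd hn ⟨t, ht⟩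
  set ρ : ℂ := ((Real.sqrt ((p : ℝ) ^ r) : ℝ) : ℂ) with hρ
  have hppos : (0 : ℝ) < (p : ℝ) ^ r := pow_pos (by exact_mod_cast hp.pos) r
  have hρ0 : ρ ≠ 0 := by
    rw [hρ]
    exact_mod_cast (Real.sqrt_pos.2 hppos).ne'
  have hρ2 : ρ ^ 2 = (p : ℂ) ^ r := by
    rw [hρ, ← Complex.ofReal_pow, Real.sq_sqrt hppos.le]
    push_cast
    rfl
  have hρm : ρ ^ m ∈ (algebraMap ℚ ℂ).fieldRange := by
    obtain ⟨k, hk⟩ := heven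
    have h1 : Real.sqrt ((p : ℝ) ^ r) ^ m = (p : ℝ) ^ k := by
      have hp0 : (0 : ℝ) ≤ p := Nat.cast_nonneg p
      refine (pow_left_inj₀ (by positivity) (by positivity) two_ne_zero).1 ?_
      rw [pow_right_comm, Real.sq_sqrt hppos.le, ← pow_mul, ← pow_mul, mul_comm r m, hk]
      congr 1
      omega
    rw [hρ, ← Complex.ofReal_pow, h1]
    push_cast
    exact pow_mem (natCast_mem _ p) k
  have hsum := aux_psum_rat (fun i => ρ * ζ i)
    (fun j => by obtain ⟨c, hc⟩ := hrat j; exact ⟨c, hc.symm⟩) m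
  have hT : ∑ i, ζ i ^ m ∈ (algebraMap ℚ ℂ).fieldRange := by
    simp only [mul_pow, ← Finset.mul_sum] at hsum
    have h := mul_mem (inv_mem hρm) hsum
    rwa [inv_mul_cancel_left₀ (pow_ne_zero _ hρ0)] at h
  have hG := aux_galois (fun i => ζ i ^ m) N t hNpos hcop
    (fun i => by rw [← pow_mul, ← hN, hζs]) hT
  simp only [← pow_mul, ← ht] at hG
  rw [hS n, hS m, hG]
  have : ρ ^ n = ρ ^ (n - m) * ρ ^ m := by rw [← pow_add, Nat.sub_add_cancel hmn]
  rw [this]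
  ring
end

section
/- Let p be an odd prime, r ≥ 1, q = p^r, and g ≥ 1. Let ζ_1, …, ζ_{2g} ∈ ℂ be roots of unity such that the polynomial ∏_{i=1}^{2g}(X - √q·ζ_i) has rational coefficients, let s be the least positive integer with ζ_i^s = 1 for all i (the period), and set S_k = -q^{k/2}·∑_{i=1}^{2g} ζ_i^k for k ≥ 1. Let n be a positive integer, m = gcd(n,s), t = n/m, and suppose m·r is odd and p does not divide t. Then S_n = q^{(n-m)/2}·S_m·((-1)^{(t-1)/2}·t / p), where (·/p) is the Legendre symbol (t is necessarily odd in this case, so (t-1)/2 is an integer, and n - m is even). -/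
/-- Power sums of a family whose monic polynomial is rational are rational. -/
theorem psum_rat {N : ℕ} (x : Fin N → ℂ)
    (h : ∀ j : ℕ, ∃ c : ℚ,
      (∏ i, (Polynomial.X - Polynomial.C (x i))).coeff j = (c : ℂ)) (k : ℕ) (hk : 0 < k) :
    ∃ c : ℚ, ∑ i, x i ^ k = (c : ℂ) := by
  have he : ∀ j, ∃ c : ℚ, MvPolynomial.aeval x (MvPolynomial.esymm (Fin N) ℚ j) = (c : ℂ) := by
    intro j
    rw [MvPolynomial.aeval_esymm_eq_multiset_esymm]
    by_cases hj : j ≤ N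
    · obtain ⟨c, hc⟩ := h (N - j)
      have h1 := Multiset.prod_X_sub_C_coeff (Multiset.map x Finset.univ.val) (k := N - j)
        (by simp)
      rw [Multiset.map_map] at h1
      have h2 : N - (N - j) = j := by omega
      simp only [Multiset.card_map, Finset.card_val, Finset.card_univ, Fintype.card_fin, h2] at h1
      have h3 := hc.symm.trans h1
      refine ⟨(-1) ^ j * c, ?_⟩
      push_cast
      rw [h3, ← mul_assoc, ← mul_pow]
      simp
    · refine ⟨0, ?_⟩
      rw [Multiset.esymm, Multiset.powersetCard_eq_empty]
      · simp
      · simpa using hj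
  induction k using Nat.strong_induction_on with
  | _ k ih =>
    have key := congrArg (MvPolynomial.aeval x)
      (MvPolynomial.psum_eq_mul_esymm_sub_sum (Fin N) ℚ k hk)
    have hl : MvPolynomial.aeval x (MvPolynomial.psum (Fin N) ℚ k) = ∑ i, x i ^ k := by
      simp [MvPolynomial.psum]
    rw [hl] at key
    rw [key]
    have hmem : ∀ z : ℂ, (∃ c : ℚ, z = (c : ℂ)) ↔ z ∈ (algebraMap ℚ ℂ).range := by
      intro z
      simp only [RingHom.mem_range, eq_ratCast]
      exact ⟨fun ⟨c, hc⟩ => ⟨c, hc.symm⟩, fun ⟨c, hc⟩ => ⟨c, hc.symm⟩⟩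
    rw [hmem]
    simp only [hmem] at he ih
    rw [map_sub, map_sum]
    refine sub_mem ?_ (sum_mem ?_)
    · simp only [map_mul, map_pow, map_neg, map_one, map_natCast]
      exact mul_mem (mul_mem (pow_mem (neg_mem (one_mem _)) _) (natCast_mem _ _)) (he _)
    · intro a ha
      have ha1 : a.1 + a.2 = k := Finset.HasAntidiagonal.mem_antidiagonal.mp (Finset.mem_filter.mp ha).1
      have ha2 : 0 < a.1 ∧ a.1 < k := (Finset.mem_filter.mp ha).2
      have h2 : MvPolynomial.aeval x (MvPolynomial.psum (Fin N) ℚ a.2) = ∑ i, x i ^ a.2 := by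
        simp [MvPolynomial.psum]
      simp only [map_mul, map_pow, map_neg, map_one, h2]
      exact mul_mem (mul_mem (pow_mem (neg_mem (one_mem _)) _) (he _))
        (ih _ (by omega) (by omega))

/-- The graph of the Galois automorphism `z ↦ z ^ t`. -/
noncomputable def galGraph (z : ℂ) (t : ℕ) : Subalgebra ℚ (ℂ × ℂ) :=
  (Polynomial.aeval (R := ℚ) ((z, z ^ t) : ℂ × ℂ)).range

theorem galGraph_rat {M : ℕ} (hM : 0 < M) {z : ℂ} (hz : IsPrimitiveRoot z M) {t : ℕ}
    (ht : Nat.Coprime t M) {c : ℚ} {y : ℂ} (h : ((c : ℂ), y) ∈ galGraph z t) : y = c := by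
  obtain ⟨P, hP⟩ := h
  have h1 : Polynomial.aeval z P = (c : ℂ) := by
    have := congrArg (AlgHom.fst ℚ ℂ ℂ) hP
    simpa [← Polynomial.aeval_algHom_apply] using this
  have h2 : Polynomial.aeval (z ^ t) P = y := by
    have := congrArg (AlgHom.snd ℚ ℂ ℂ) hP
    simpa [← Polynomial.aeval_algHom_apply] using this
  have hz2 : IsPrimitiveRoot (z ^ t) M := hz.pow_of_coprime t ht
  have e1 := Polynomial.cyclotomic_eq_minpoly_rat hz hM
  have e2 := Polynomial.cyclotomic_eq_minpoly_rat hz2 hM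
  have h3 : Polynomial.aeval z (P - Polynomial.C c) = 0 := by simp [h1]
  have h4 := minpoly.dvd ℚ z h3
  rw [← e1, e2] at h4
  have h5 := (minpoly.aeval ℚ (z ^ t))
  have h6 := Polynomial.aeval_eq_zero_of_dvd_aeval_eq_zero h4 h5
  simp only [map_sub, h2, Polynomial.aeval_C, eq_ratCast] at h6
  exact sub_eq_zero.mp h6

theorem galGraph_root {M : ℕ} (hM : 0 < M) {z : ℂ} (hz : IsPrimitiveRoot z M) {t : ℕ}
    {x : ℂ} (hx : x ^ M = 1) : (x, x ^ t) ∈ galGraph z t := by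
  haveI : NeZero M := ⟨hM.ne'⟩
  obtain ⟨i, -, rfl⟩ := hz.eq_pow_of_pow_eq_one hx
  refine ⟨Polynomial.X ^ i, ?_⟩
  simp only [RingHom.coe_coe, AlgHom.toRingHom_eq_coe, map_pow, Polynomial.aeval_X, Prod.pow_mk]
  rw [← pow_mul, ← pow_mul, mul_comm]

theorem galGraph_rat_mem (z : ℂ) (t : ℕ) (c : ℚ) : ((c : ℂ), (c : ℂ)) ∈ galGraph z t := by
  have := (galGraph z t).algebraMap_mem c
  simpa using this

theorem galGraph_gauss (p : ℕ) [Fact p.Prime] (hp2 : p ≠ 2) {M : ℕ} (hM : 0 < M) (hpM : p ∣ M)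
    {z : ℂ} (hz : IsPrimitiveRoot z M) {t : ℕ} (hpt : ¬ p ∣ t) :
    ∃ G : ℂ, G ^ 2 = (legendreSym p (-1) : ℂ) * p ∧
      (G, (legendreSym p t : ℂ) * G) ∈ galGraph z t := by
  set χ : MulChar (ZMod p) ℂ := (quadraticChar (ZMod p)).ringHomComp (Int.castRingHom ℂ) with hχ
  have hχq : χ.IsQuadratic := (quadraticChar_isQuadratic (ZMod p)).comp _
  have hχ1 : χ ≠ 1 := by
    have := quadraticChar_ne_one (F := ZMod p) (by rwa [ZMod.ringChar_zmod_n])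
    rw [hχ]
    exact (MulChar.ringHomComp_ne_one_iff (Int.cast_injective)).mpr this
  have hψ := ZMod.isPrimitive_stdAddChar p
  refine ⟨gaussSum χ ZMod.stdAddChar, ?_, ?_⟩
  · rw [gaussSum_sq hχ1 hχq hψ]
    simp [hχ, legendreSym, ZMod.card]
  · have htu : IsUnit (t : ZMod p) := by
      rw [isUnit_iff_ne_zero, Ne, ZMod.natCast_eq_zero_iff]
      exact hpt
    obtain ⟨u, hu⟩ := htu
    have h1 := gaussSum_mulShift_eq χ (ZMod.stdAddChar (N := p)) u
    rw [hχq.inv, hu] at h1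
    have h2 : χ (t : ZMod p) = (legendreSym p t : ℂ) := by
      simp [hχ, legendreSym]
    rw [← h2, ← h1]
    simp only [gaussSum]
    have : ((∑ a, χ a * ZMod.stdAddChar a,
        ∑ a, χ a * (AddChar.mulShift (ZMod.stdAddChar (N := p)) (t : ZMod p)) a) : ℂ × ℂ)
        = ∑ a, (((χ a, χ a) : ℂ × ℂ) *
          ((ZMod.stdAddChar a : ℂ), (ZMod.stdAddChar a : ℂ) ^ t)) := by
      ext
      · simp [Prod.fst_sum]
      · simp only [Prod.snd_sum, Prod.mk_mul_mk, AddChar.mulShift_apply]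
        refine Finset.sum_congr rfl fun a _ => ?_
        rw [← AddChar.map_nsmul_eq_pow, nsmul_eq_mul]
    rw [this]
    refine sum_mem fun a _ => mul_mem ?_ (galGraph_root hM hz ?_)
    · have := galGraph_rat_mem z t (quadraticChar (ZMod p) a : ℚ)
      simpa [hχ] using this
    · obtain ⟨d, rfl⟩ := hpM
      rw [pow_mul, ← AddChar.map_nsmul_eq_pow]
      simp

theorem galGraph_sqrt (p : ℕ) [Fact p.Prime] (hp2 : p ≠ 2) {M : ℕ} (hM : 0 < M) (hpM : p ∣ M)
    (h4M : 4 ∣ M)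
    {z : ℂ} (hz : IsPrimitiveRoot z M) {t : ℕ} (hpt : ¬ p ∣ t) (hodd : Odd t) :
    (((Real.sqrt p : ℝ) : ℂ),
      (legendreSym p ((-1) ^ ((t - 1) / 2) * (t : ℤ)) : ℂ) * ((Real.sqrt p : ℝ) : ℂ))
        ∈ galGraph z t := by
  obtain ⟨G, hG, hGm⟩ := galGraph_gauss p hp2 hM hpM hz hpt
  have hsq : ((Real.sqrt p : ℝ) : ℂ) ^ 2 = p := by
    rw [← Complex.ofReal_pow, Real.sq_sqrt (Nat.cast_nonneg p)]
    simp
  have hleg : legendreSym p ((-1) ^ ((t - 1) / 2) * (t : ℤ)) =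
      legendreSym p (-1) ^ ((t - 1) / 2) * legendreSym p t := by
    rw [legendreSym.mul]
    congr 1
    exact map_pow (legendreSym.hom p) (-1) _
  obtain ⟨k, hk⟩ := hodd
  have hk2 : (t - 1) / 2 = k := by omega
  rw [hleg, hk2]
  have h1 : legendreSym p (-1) = 1 ∨ legendreSym p (-1) = -1 := by
    apply legendreSym.eq_one_or_neg_one
    simp
  obtain ⟨H, hH, hHm⟩ : ∃ H : ℂ, H ^ 2 = p ∧
      (H, ((legendreSym p (-1) ^ k * legendreSym p t : ℤ) : ℂ) * H) ∈ galGraph z t := by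
    rcases h1 with h1 | h1
    · refine ⟨G, ?_, ?_⟩
      · rw [hG, h1]; simp
      · rw [h1]; simpa using hGm
    · refine ⟨Complex.I * G, ?_, ?_⟩
      · rw [mul_pow, hG, h1]; simp
      · have hI : (Complex.I, Complex.I ^ t) ∈ galGraph z t := by
          apply galGraph_root hM hz
          obtain ⟨d, rfl⟩ := h4M
          rw [pow_mul]; simp
        have hm := mul_mem hI hGm
        have : Complex.I ^ t = (-1) ^ k * Complex.I := by
          rw [hk, pow_succ, pow_mul]; simp
        rw [Prod.mk_mul_mk, this] at hm
        rw [h1]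
        convert hm using 2
        push_cast
        ring
  have h2 : ((Real.sqrt p : ℝ) : ℂ) = H ∨ ((Real.sqrt p : ℝ) : ℂ) = -H := by
    apply sq_eq_sq_iff_eq_or_eq_neg.mp
    rw [hsq, hH]
  rcases h2 with h2 | h2
  · rw [h2]; exact hHm
  · rw [h2]
    have := neg_mem hHm
    simpa using this

/-- Reduction theorem for supersingular curves, `p` odd, case `m·r` odd and `p ∤ t`:
with `q = p^r`, `ζ_1, …, ζ_{2g}` roots of unity of period `s` such that `∏ (X - √q·ζ_i)`
has rational coefficients, `S_k = -q^{k/2}·∑ ζ_i^k`, `n > 0`, `m = gcd(n,s)`, `t = n/m`,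
`m·r` odd and `p ∤ t`, we have `S_n = q^{(n-m)/2}·S_m·((-1)^{(t-1)/2}·t / p)`. -/
theorem reduction_odd_not_dvd (p r g : ℕ) [Fact p.Prime] (hp2 : p ≠ 2)
    (hr : 1 ≤ r) (hg : 1 ≤ g)
    (ζ : Fin (2 * g) → ℂ) (s : ℕ) (hs : 0 < s) (hζs : ∀ i, ζ i ^ s = 1)
    (hleast : ∀ s' : ℕ, 0 < s' → (∀ i, ζ i ^ s' = 1) → s ≤ s')
    (hrat : ∀ j : ℕ, ∃ c : ℚ,
      (∏ i, (Polynomial.X -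
        Polynomial.C (((Real.sqrt ((p : ℝ) ^ r) : ℝ) : ℂ) * ζ i))).coeff j = (c : ℂ))
    (S : ℕ → ℂ)
    (hS : ∀ k : ℕ, S k = -((Real.sqrt ((p : ℝ) ^ r) : ℝ) : ℂ) ^ k * ∑ i, ζ i ^ k)
    (n : ℕ) (hn : 0 < n) (m t : ℕ) (hm : m = Nat.gcd n s) (ht : t = n / m)
    (hodd : Odd (m * r)) (hpt : ¬ p ∣ t) :
    S n = ((Real.sqrt ((p : ℝ) ^ r) : ℝ) : ℂ) ^ (n - m) * S m *
      ((legendreSym p ((-1) ^ ((t - 1) / 2) * (t : ℤ)) : ℤ) : ℂ) := by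
  have hpp : p.Prime := Fact.out
  have hp0 : (p : ℝ) ≠ 0 := by exact_mod_cast hpp.ne_zero
  obtain ⟨hmo, hro⟩ := Nat.odd_mul.mp hodd
  set Q : ℂ := ((Real.sqrt ((p : ℝ) ^ r) : ℝ) : ℂ) with hQ
  -- odd powers of `√q`
  have hQk : ∀ k, Odd k → ∃ e : ℕ, Q ^ k = (p : ℂ) ^ e * ((Real.sqrt p : ℝ) : ℂ) := by
    intro k hk
    obtain ⟨e, he⟩ := hro.mul hk
    refine ⟨e, ?_⟩
    have h1 : Real.sqrt ((p : ℝ) ^ r) = Real.sqrt p ^ r := by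
      rw [Real.sqrt_eq_iff_eq_sq (by positivity) (by positivity), ← pow_mul, mul_comm, pow_mul,
        Real.sq_sqrt (Nat.cast_nonneg p)]
    rw [hQ, h1, ← Complex.ofReal_pow, ← pow_mul, he, pow_succ, pow_mul,
      Real.sq_sqrt (Nat.cast_nonneg p)]
    push_cast
    ring
  have hQ0 : Q ≠ 0 := by
    rw [hQ]
    have : Real.sqrt ((p : ℝ) ^ r) ≠ 0 := by
      have : 0 < (p : ℝ) := by exact_mod_cast hpp.pos
      positivity
    exact_mod_cast this
  have hratS : ∀ k, 0 < k → ∃ c : ℚ, Q ^ k * ∑ i, ζ i ^ k = (c : ℂ) := by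
    intro k hk
    obtain ⟨c, hc⟩ := psum_rat (fun i => Q * ζ i) hrat k hk
    refine ⟨c, ?_⟩
    rw [← hc, Finset.mul_sum]
    simp [mul_pow]
  -- the period is even
  have hseven : Even s := by
    by_contra hns
    rw [Nat.not_even_iff_odd] at hns
    obtain ⟨c, hc⟩ := hratS s hs
    obtain ⟨e, he⟩ := hQk s hns
    simp only [hζs, Finset.sum_const, Finset.card_univ, Fintype.card_fin, he] at hc
    have hirr := hpp.irrational_sqrt
    apply hirr
    have hg0 : (g : ℝ) ≠ 0 := by
      have : g ≠ 0 := by omega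
      exact_mod_cast this
    refine ⟨c / ((p : ℚ) ^ e * (2 * g)), ?_⟩
    have hc' : (p : ℝ) ^ e * Real.sqrt p * (2 * g) = c := by
      have : (((p : ℝ) ^ e * Real.sqrt p * (2 * g) : ℝ) : ℂ) = ((c : ℝ) : ℂ) := by
        push_cast
        rw [← hc]
        simp
      exact_mod_cast this
    push_cast
    rw [← hc']
    field_simp
  have hm0 : 0 < m := hmo.pos
  have hmn : m ∣ n := hm ▸ Nat.gcd_dvd_left n s
  have hms : m ∣ s := hm ▸ Nat.gcd_dvd_right n s
  have hnmt : n = m * t := by rw [ht, Nat.mul_div_cancel' hmn]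
  obtain ⟨N, hN⟩ := hms
  have hcop : Nat.Coprime t N := by
    have : m * Nat.gcd t N = m * 1 := by
      rw [← Nat.gcd_mul_left, ← hnmt, ← hN, ← hm, mul_one]
    exact Nat.eq_of_mul_eq_mul_left hm0 this
  have hNeven : 2 ∣ N := by
    rw [hN, Nat.even_mul] at hseven
    rcases hseven with h | h
    · exact absurd h (Nat.not_even_iff_odd.mpr hmo)
    · exact h.two_dvd
  have hN0 : 0 < N := Nat.pos_of_ne_zero (by rintro rfl; simp at hN; omega)
  have hto : Odd t := by
    rw [← Nat.coprime_two_right]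
    exact hcop.coprime_dvd_right hNeven
  set M := 4 * p * N with hMdef
  have hM : 0 < M := by have := hpp.pos; positivity
  have hcM : Nat.Coprime t M := by
    refine Nat.Coprime.mul_right (Nat.Coprime.mul_right ?_ ?_) hcop
    · exact Nat.Coprime.pow_right 2 (Nat.coprime_two_right.mpr hto)
    · exact ((Nat.Prime.coprime_iff_not_dvd hpp).mpr hpt).symm
  have hz := Complex.isPrimitiveRoot_exp M hM.ne'
  set z := Complex.exp (2 * Real.pi * Complex.I / M) with hzdef
  have hsqrt := galGraph_sqrt p hp2 hM (Dvd.intro_left (4 * N) (by rw [hMdef]; ring))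
    (Dvd.intro (p * N) (by rw [hMdef]; ring)) hz hpt hto
  set L : ℂ := ((legendreSym p ((-1) ^ ((t - 1) / 2) * (t : ℤ)) : ℤ) : ℂ) with hL
  have hsum : ((∑ i, ζ i ^ m, ∑ i, ζ i ^ n) : ℂ × ℂ) ∈ galGraph z t := by
    have : ((∑ i, ζ i ^ m, ∑ i, ζ i ^ n) : ℂ × ℂ) = ∑ i, (ζ i ^ m, (ζ i ^ m) ^ t) := by
      ext
      · simp [Prod.fst_sum]
      · simp [Prod.snd_sum, hnmt, pow_mul]
    rw [this]
    refine sum_mem fun i _ => galGraph_root hM hz ?_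
    rw [← pow_mul, show m * M = s * (4 * p) by rw [hMdef, hN]; ring, pow_mul, hζs, one_pow]
  obtain ⟨c, hc⟩ := hratS m hm0
  obtain ⟨e, he⟩ := hQk m hmo
  have hpow := galGraph_rat_mem z t ((p : ℚ) ^ e)
  have hall := mul_mem (mul_mem hpow hsqrt) hsum
  simp only [Prod.mk_mul_mk] at hall
  push_cast at hall
  rw [← he, hc] at hall
  have hfin := galGraph_rat hM hz hcM hall
  have hL2 : L * L = 1 := by
    have : legendreSym p ((-1) ^ ((t - 1) / 2) * (t : ℤ)) ^ 2 = 1 := by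
      apply legendreSym.sq_one
      have : (t : ZMod p) ≠ 0 := by
        rw [Ne, ZMod.natCast_eq_zero_iff]; exact hpt
      simpa using this
    rw [hL, ← sq]
    exact_mod_cast this
  have hfin2 : L * (Q ^ m * ∑ i, ζ i ^ n) = Q ^ m * ∑ i, ζ i ^ m := by
    rw [hc, ← hfin, he]; ring
  have hfin3 : ∑ i, ζ i ^ n = L * ∑ i, ζ i ^ m := by
    apply mul_left_cancel₀ (pow_ne_zero m hQ0)
    linear_combination L * hfin2 - (Q ^ m * ∑ i, ζ i ^ n) * hL2
  have hle : m ≤ n := Nat.le_of_dvd hn hmn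
  rw [hS, hS, hfin3]
  have : Q ^ n = Q ^ (n - m) * Q ^ m := by rw [← pow_add, Nat.sub_add_cancel hle]
  rw [this]
  ring
end

section
/- Let p be an odd prime, r ≥ 1, q = p^r, and g ≥ 1. Let ζ_1, …, ζ_{2g} ∈ ℂ be roots of unity such that the polynomial ∏_{i=1}^{2g}(X - √q·ζ_i) has rational coefficients, let s be the least positive integer with ζ_i^s = 1 for all i (the period), and set S_k = -q^{k/2}·∑_{i=1}^{2g} ζ_i^k for k ≥ 1. Let n be a positive integer, m = gcd(n,s), t = n/m, and suppose m·r is odd and p divides t. Then S_n = q^{(n-m)/2}·S_m (with n - m even in this case). -/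
open Polynomial in
theorem aux_frob (p : ℕ) (hp : p.Prime) (P : ℤ[X]) (f : ℕ) :
    ∃ Q : ℤ[X], P ^ p ^ f = expand ℤ (p ^ f) P + C (p : ℤ) * Q := by
  haveI := Fact.mk hp
  have key : ∀ f : ℕ, ∀ R : (ZMod p)[X], expand (ZMod p) (p ^ f) R = R ^ p ^ f := by
    intro f
    induction f with
    | zero => intro R; simp
    | succ k ih => intro R; rw [pow_succ, expand_mul, ZMod.expand_card, map_pow, ih, ← pow_mul]
  have h0 : (P ^ p ^ f - expand ℤ (p ^ f) P).map (Int.castRingHom (ZMod p)) = 0 := by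
    rw [Polynomial.map_sub, Polynomial.map_pow, Polynomial.map_expand, key, sub_self]
  have hd : C (p : ℤ) ∣ P ^ p ^ f - expand ℤ (p ^ f) P := by
    rw [C_dvd_iff_dvd_coeff]
    intro i
    have := congrArg (fun R => R.coeff i) h0
    simp only [coeff_map, coeff_zero] at this
    exact (ZMod.intCast_zmod_eq_zero_iff_dvd _ p).1 (by simpa using this)
  obtain ⟨Q, hQ⟩ := hd
  exact ⟨Q, by rw [← hQ]; ring⟩

theorem aux_rat_int (b : ℚ) (h : IsIntegral ℤ (b : ℂ)) : ∃ e : ℤ, b = e := by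
  have h1 : IsIntegral ℤ b := by
    have : IsIntegral ℤ (algebraMap ℚ ℂ b) := by simpa using h
    exact (isIntegral_algebraMap_iff (algebraMap ℚ ℂ).injective).1 this
  obtain ⟨e, he⟩ := IsIntegrallyClosed.isIntegral_iff.1 h1
  exact ⟨e, by simpa using he.symm⟩

open Polynomial in
theorem aux_int (ω : ℂ) (hω : IsIntegral ℤ ω) (P : ℤ[X]) : IsIntegral ℤ (aeval ω P) := by
  exact adjoin_le_integralClosure hω (aeval_mem_adjoin_singleton ℤ ω)

open Polynomial in
theorem aux_descent (p d : ℕ) (hp : p.Prime) (hd : 0 < d) (hpd : p.Coprime d) (ω : ℂ)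
    (hω : ω ^ d = 1) : ∀ (N : ℕ) (e : ℤ) (P : ℤ[X]), e.natAbs ≤ N →
      (aeval ω P) ^ 2 = (p : ℂ) * (e : ℂ) ^ 2 → e = 0 := by
  have hp0 : (p : ℂ) ≠ 0 := by exact_mod_cast hp.ne_zero
  have hωi : IsIntegral ℤ ω := IsIntegral.of_pow hd (by rw [hω]; exact isIntegral_one)
  intro N
  induction N with
  | zero => intro e P he _; omega
  | succ N ih =>
    intro e P he hP
    obtain ⟨Q, hQ⟩ := aux_frob p hp P d.totient
    have hmod : p ^ d.totient ≡ 1 [MOD d] := Nat.ModEq.pow_totient hpd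
    have hfix : ω ^ p ^ d.totient = ω := by
      have := pow_eq_pow_of_modEq hmod hω
      simpa using this
    have h2 : 2 ≤ p ^ d.totient :=
      hp.two_le.trans (Nat.le_self_pow (Nat.totient_pos.2 hd).ne' p)
    obtain ⟨k, hk⟩ := Nat.exists_eq_add_of_le h2
    have hev := congrArg (aeval ω) hQ
    simp only [map_pow, map_add, map_mul, expand_aeval, aeval_C, hfix] at hev
    rw [hk, pow_add, hP] at hev
    have hy : aeval ω P = p * aeval ω (C (e ^ 2) * P ^ k - Q) := by
      simp only [map_sub, map_mul, map_pow, aeval_C] at hev ⊢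
      simp at hev ⊢
      linear_combination -hev
    set Y := C (e ^ 2) * P ^ k - Q with hY
    have hy2 : (p : ℂ) * (aeval ω Y) ^ 2 = (e : ℂ) ^ 2 := by
      rw [hy] at hP
      have : (p : ℂ) * (p * (aeval ω Y) ^ 2) = p * (e : ℂ) ^ 2 := by rw [← hP]; ring
      exact mul_left_cancel₀ hp0 this
    have hyi : IsIntegral ℤ (((e ^ 2 / p : ℚ)) : ℂ) := by
      have : (((e ^ 2 / p : ℚ)) : ℂ) = aeval ω (Y ^ 2) := by
        push_cast
        rw [← hy2, map_pow]
        field_simp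
      rw [this]
      exact aux_int ω hωi _
    obtain ⟨M, hM⟩ := aux_rat_int _ hyi
    have hpe : (p : ℤ) ∣ e := by
      have hp0' : (p : ℚ) ≠ 0 := by exact_mod_cast hp.ne_zero
      rw [div_eq_iff hp0'] at hM
      have : e ^ 2 = M * p := by exact_mod_cast hM
      exact (Nat.prime_iff_prime_int.1 hp).dvd_of_dvd_pow (Dvd.intro_left M this.symm)
    obtain ⟨e', rfl⟩ := hpe
    have : e' = 0 ∨ e'.natAbs ≤ N := by
      by_cases h : e' = 0
      · exact Or.inl h
      · right
        rw [Int.natAbs_mul, Int.natAbs_natCast] at he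
        have : 0 < e'.natAbs := Int.natAbs_pos.2 h
        have := hp.two_le
        nlinarith
    rcases this with h | h
    · simp [h]
    · rw [ih e' Y h ?_, mul_zero]
      push_cast at hy2
      apply mul_left_cancel₀ hp0
      rw [hy2]; ring

theorem aux_psum (N : ℕ) (z : Fin N → ℂ)
    (hrat : ∀ j : ℕ, ∃ c : ℚ,
      (∏ i, (Polynomial.X - Polynomial.C (z i))).coeff j = (c : ℂ)) (k : ℕ) :
    ∃ c : ℚ, ∑ i, z i ^ k = (c : ℂ) := by
  have hes : ∀ j, ∃ c : ℚ, MvPolynomial.aeval z (MvPolynomial.esymm (Fin N) ℤ j) = (c : ℂ) := by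
    intro j
    rw [MvPolynomial.aeval_esymm_eq_multiset_esymm]
    have hc : Multiset.card (Finset.univ.val.map z) = N := by simp
    by_cases hj : j ≤ N
    · obtain ⟨c, hc'⟩ := hrat (N - j)
      have h1 := Multiset.prod_X_sub_C_coeff (Finset.univ.val.map z) (k := N - j) (by omega)
      rw [hc, Nat.sub_sub_self hj, Multiset.map_map] at h1
      have h2 : (Multiset.map ((fun t => Polynomial.X - Polynomial.C t) ∘ z)
        Finset.univ.val).prod = ∏ i, (Polynomial.X - Polynomial.C (z i)) := rfl
      rw [h2, hc'] at h1
      refine ⟨(-1) ^ j * c, ?_⟩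
      push_cast
      rw [h1, ← mul_assoc, ← mul_pow]
      simp
    · refine ⟨0, ?_⟩
      rw [Multiset.esymm, Multiset.powersetCard_eq_empty _ (by omega)]
      simp
  choose E hE using hes
  have main : ∀ k, ∃ c : ℚ, MvPolynomial.aeval z (MvPolynomial.psum (Fin N) ℤ k) = (c : ℂ) := by
    intro k
    induction k using Nat.strong_induction_on with
    | _ k ih =>
      rcases Nat.eq_zero_or_pos k with rfl | hk
      · exact ⟨N, by simp [MvPolynomial.psum]⟩
      · choose! F hF using ih
        rw [MvPolynomial.psum_eq_mul_esymm_sub_sum _ _ k hk]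
        refine ⟨(-1) ^ (k + 1) * k * E k - ∑ a ∈ (Finset.HasAntidiagonal.antidiagonal k).filter
          (fun a => a.1 ∈ Set.Ioo 0 k), (-1) ^ a.1 * E a.1 * F a.2, ?_⟩
        simp only [map_sub, map_mul, map_sum, map_pow, map_neg, map_one, map_natCast, hE]
        push_cast
        congr 1
        refine Finset.sum_congr rfl fun a ha => ?_
        rw [hF]
        simp only [Finset.mem_filter, Finset.HasAntidiagonal.mem_antidiagonal, Set.mem_Ioo] at ha
        omega
  obtain ⟨c, hc⟩ := main k
  exact ⟨c, by rw [← hc]; simp [MvPolynomial.psum]⟩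


/-- Reduction theorem for supersingular curves, `p` odd, case `m·r` odd and `p ∣ t`:
with `q = p^r`, `ζ_1, …, ζ_{2g}` roots of unity of period `s` such that `∏ (X - √q·ζ_i)`
has rational coefficients, `S_k = -q^{k/2}·∑ ζ_i^k`, `n > 0`, `m = gcd(n,s)`, `t = n/m`,
`m·r` odd and `p ∣ t`, we have `S_n = q^{(n-m)/2}·S_m`. -/
theorem reduction_odd_dvd (p r g : ℕ) (hp : p.Prime) (hp2 : p ≠ 2)
    (hr : 1 ≤ r) (hg : 1 ≤ g)
    (ζ : Fin (2 * g) → ℂ) (s : ℕ) (hs : 0 < s) (hζs : ∀ i, ζ i ^ s = 1)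
    (hleast : ∀ s' : ℕ, 0 < s' → (∀ i, ζ i ^ s' = 1) → s ≤ s')
    (hrat : ∀ j : ℕ, ∃ c : ℚ,
      (∏ i, (Polynomial.X -
        Polynomial.C (((Real.sqrt ((p : ℝ) ^ r) : ℝ) : ℂ) * ζ i))).coeff j = (c : ℂ))
    (S : ℕ → ℂ)
    (hS : ∀ k : ℕ, S k = -((Real.sqrt ((p : ℝ) ^ r) : ℝ) : ℂ) ^ k * ∑ i, ζ i ^ k)
    (n : ℕ) (hn : 0 < n) (m t : ℕ) (hm : m = Nat.gcd n s) (ht : t = n / m)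
    (hodd : Odd (m * r)) (hpt : p ∣ t) :
    S n = ((Real.sqrt ((p : ℝ) ^ r) : ℝ) : ℂ) ^ (n - m) * S m := by
  have hm0 : 0 < m := by rw [hm]; exact Nat.gcd_pos_of_pos_left _ hn
  obtain ⟨d, hd⟩ : m ∣ s := hm ▸ Nat.gcd_dvd_right n s
  obtain ⟨t', ht'⟩ : m ∣ n := hm ▸ Nat.gcd_dvd_left n s
  have htt : t = t' := by rw [ht, ht', Nat.mul_div_cancel_left _ hm0]
  subst htt
  have hd0 : 0 < d := Nat.pos_of_ne_zero (by rintro rfl; simp at hd; omega)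
  have hcop : t.Coprime d := by
    have h1 : m * Nat.gcd t d = m * 1 := by
      rw [← Nat.gcd_mul_left, ← ht', ← hd, ← hm, mul_one]
    exact Nat.eq_of_mul_eq_mul_left hm0 h1
  have hpd : p.Coprime d := Nat.Coprime.coprime_dvd_left hpt hcop
  haveI : NeZero d := ⟨hd0.ne'⟩
  obtain ⟨ω, hω⟩ : ∃ ω : ℂ, IsPrimitiveRoot ω d :=
    ⟨_, Complex.isPrimitiveRoot_exp d hd0.ne'⟩
  have hpw : ∀ i, ∃ a : ℕ, ω ^ a = ζ i ^ m := by
    intro i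
    obtain ⟨a, _, ha⟩ := hω.eq_pow_of_pow_eq_one (ξ := ζ i ^ m) (by rw [← pow_mul, ← hd, hζs])
    exact ⟨a, ha⟩
  choose a ha using hpw
  set P : Polynomial ℤ := ∑ i, Polynomial.X ^ a i with hP
  have hPm : Polynomial.aeval ω P = ∑ i, ζ i ^ m := by
    simp [hP, ha]
  have hPn : Polynomial.aeval (ω ^ t) P = ∑ i, ζ i ^ n := by
    simp only [hP, map_sum, map_pow, Polynomial.aeval_X]
    refine Finset.sum_congr rfl fun i _ => ?_
    rw [← pow_mul, mul_comm, pow_mul, ha, ← pow_mul, ← ht']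
  have hp0 : (p : ℂ) ≠ 0 := by exact_mod_cast hp.ne_zero
  have hωi : IsIntegral ℤ ω := hω.isIntegral hd0
  have hzero : Polynomial.aeval ω P = 0 := by
    obtain ⟨c, hc⟩ := aux_psum (2 * g) _ hrat m
    simp only [mul_pow] at hc
    rw [← Finset.mul_sum, ← hPm] at hc
    have hsq : (((Real.sqrt ((p : ℝ) ^ r) : ℝ) : ℂ)) ^ 2 = (p : ℂ) ^ r := by
      rw [← Complex.ofReal_pow, Real.sq_sqrt (by positivity)]
      push_cast; rfl
    obtain ⟨k, hk⟩ := hodd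
    have hc2 : (p : ℂ) ^ (2 * k + 1) * (Polynomial.aeval ω P) ^ 2 = (c : ℂ) ^ 2 := by
      rw [← hc, mul_pow, ← pow_mul, mul_comm m 2, pow_mul, hsq, ← pow_mul, mul_comm r m, hk]
    have hb : (p : ℂ) * (Polynomial.aeval ω P) ^ 2 = ((c / p ^ k : ℚ) : ℂ) ^ 2 := by
      push_cast
      rw [div_pow, ← hc2]
      field_simp
      ring
    have hbi : IsIntegral ℤ ((c / p ^ k : ℚ) : ℂ) := by
      refine IsIntegral.of_pow (n := 2) (by norm_num) ?_
      rw [← hb]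
      have := aux_int ω hωi (Polynomial.C (p : ℤ) * P ^ 2)
      simpa using this
    obtain ⟨e, he⟩ := aux_rat_int _ hbi
    rw [he] at hb
    have he0 : e = 0 := by
      refine aux_descent p d hp hd0 hpd ω hω.pow_eq_one e.natAbs e
        (Polynomial.C (p : ℤ) * P) le_rfl ?_
      simp only [map_mul, Polynomial.aeval_C]
      simp at hb ⊢
      linear_combination (p : ℂ) * hb
    rw [he0] at hb
    simpa [hp0] using hb
  have hzero' : Polynomial.aeval (ω ^ t) P = 0 := by
    have h1 : minpoly ℤ ω = minpoly ℤ (ω ^ t) := hω.minpoly_eq_pow_coprime hcop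
    have h2 : minpoly ℤ ω ∣ P := minpoly.isIntegrallyClosed_dvd hωi hzero
    rw [h1] at h2
    exact Polynomial.aeval_eq_zero_of_dvd_aeval_eq_zero h2 (minpoly.aeval ℤ _)
  rw [hS, hS, ← hPm, ← hPn, hzero, hzero']
  simp
end

section
/- Let p = 2, r ≥ 1, q = 2^r, and g ≥ 1. Let ζ_1, …, ζ_{2g} ∈ ℂ be roots of unity such that the polynomial ∏_{i=1}^{2g}(X - √q·ζ_i) has rational coefficients, let s be the least positive integer with ζ_i^s = 1 for all i (the period), and set S_k = -q^{k/2}·∑_{i=1}^{2g} ζ_i^k for k ≥ 1. Let n be a positive integer, m = gcd(n,s), t = n/m, and suppose m·r is odd. Then S_n = q^{(n-m)/2}·S_m·(-1)^{(t²-1)/8} (t is necessarily odd in this case, so (t²-1)/8 is an integer, and n - m is even). -/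
/-- Power sums of the roots of a polynomial with rational coefficients are rational. -/
theorem rc_psum_rat (N : ℕ) (y : Fin N → ℂ)
    (hrat : ∀ j : ℕ, ∃ c : ℚ,
      (∏ i, (Polynomial.X - Polynomial.C (y i))).coeff j = (c : ℂ)) (k : ℕ) :
    ∃ c : ℚ, ∑ i, y i ^ k = (c : ℂ) := by
  have hes : ∀ k : ℕ, MvPolynomial.aeval y (MvPolynomial.esymm (Fin N) ℚ k) ∈
      (algebraMap ℚ ℂ).range := by
    intro k
    rw [MvPolynomial.aeval_esymm_eq_multiset_esymm]
    set M : Multiset ℂ := Multiset.map y Finset.univ.val with hM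
    have hcard : Multiset.card M = N := by simp [hM]
    by_cases hk : k ≤ N
    · obtain ⟨c, hc⟩ := hrat (N - k)
      have h1 := Multiset.prod_X_sub_C_coeff M (k := N - k) (by omega)
      have h2 : (M.map fun t => Polynomial.X - Polynomial.C t).prod =
          ∏ i, (Polynomial.X - Polynomial.C (y i)) := by
        simp only [hM, Multiset.map_map]
        rfl
      rw [h2, hc, hcard, Nat.sub_sub_self hk] at h1
      have h3 : M.esymm k = (-1) ^ k * (c : ℂ) := by
        rw [h1, ← mul_assoc, ← mul_pow]
        simp
      rw [h3]
      exact ⟨(-1) ^ k * c, by simp⟩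
    · have : M.esymm k = 0 := by
        rw [Multiset.esymm, Multiset.powersetCard_eq_empty _ (by omega)]
        simp
      rw [this]
      exact zero_mem _
  have hps : ∀ k : ℕ, MvPolynomial.aeval y (MvPolynomial.psum (Fin N) ℚ k) ∈
      (algebraMap ℚ ℂ).range := by
    intro k
    induction k using Nat.strong_induction_on with
    | _ k ih =>
      rcases Nat.eq_zero_or_pos k with rfl | hk
      · simp only [MvPolynomial.psum_zero, map_natCast]
        exact natCast_mem _ _
      · rw [MvPolynomial.psum_eq_mul_esymm_sub_sum _ _ k hk]
        simp only [map_sub, map_mul, map_sum, map_pow, map_neg, map_one, map_natCast]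
        have hneg : ∀ e : ℕ, (-1 : ℂ) ^ e ∈ (algebraMap ℚ ℂ).range := fun e =>
          pow_mem (neg_mem (one_mem _)) e
        refine sub_mem (mul_mem (mul_mem (hneg _) (natCast_mem _ _)) (hes _)) ?_
        refine sum_mem fun a ha => ?_
        simp only [Finset.mem_filter, Set.mem_Ioo] at ha
        have ha1 := Finset.HasAntidiagonal.mem_antidiagonal.mp ha.1
        exact mul_mem (mul_mem (hneg _) (hes _)) (ih _ (by omega))
  obtain ⟨c, hc⟩ := hps k
  refine ⟨c, ?_⟩
  have h : MvPolynomial.aeval y (MvPolynomial.psum (Fin N) ℚ k) = ∑ i, y i ^ k := by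
    simp [MvPolynomial.psum]
  rw [← h, ← hc]
  simp

/-- A rational polynomial relation at a primitive root of unity survives conjugation. -/
theorem rc_conj (N : ℕ) (hN : 0 < N) (w : ℂ) (hw : IsPrimitiveRoot w N) (a : ℕ)
    (ha : a.Coprime N) (f : Polynomial ℚ) (c : ℚ) (h : Polynomial.aeval w f = (c : ℂ)) :
    Polynomial.aeval (w ^ a) f = (c : ℂ) := by
  have hwa : IsPrimitiveRoot (w ^ a) N := hw.pow_of_coprime a ha
  have h0 : Polynomial.aeval w (f - Polynomial.C c) = 0 := by
    simp [h]
  have hd := minpoly.dvd ℚ w h0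
  rw [← Polynomial.cyclotomic_eq_minpoly_rat hw hN,
    Polynomial.cyclotomic_eq_minpoly_rat hwa hN] at hd
  have h1 := Polynomial.aeval_eq_zero_of_dvd_aeval_eq_zero hd (minpoly.aeval ℚ (w ^ a))
  simpa [sub_eq_zero] using h1

/-- The quadratic Gauss sum modulo `8`. -/
theorem rc_gauss (v : ℂ) (hv4 : v ^ 4 = -1) (hv : v + v ^ 7 = ((Real.sqrt 2 : ℝ) : ℂ))
    (a : ℕ) (ha : Odd a) :
    v ^ a + v ^ (7 * a) = (-1 : ℂ) ^ ((a ^ 2 - 1) / 8) * ((Real.sqrt 2 : ℝ) : ℂ) := by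
  rw [← hv]
  have h8 : v ^ 8 = 1 := by
    rw [show 8 = 4 * 2 from rfl, pow_mul, hv4]; norm_num
  obtain ⟨u, b, hb, rfl⟩ : ∃ u b, b < 8 ∧ a = 8 * u + b :=
    ⟨a / 8, a % 8, by omega, by omega⟩
  have e1 : v ^ (8 * u + b) = v ^ b := by rw [pow_add, pow_mul, h8]; simp
  have e2 : v ^ (7 * (8 * u + b)) = v ^ (7 * b) := by
    rw [show 7 * (8 * u + b) = 8 * (7 * u) + 7 * b by ring, pow_add, pow_mul, h8]; simp
  rw [e1, e2]
  have key : ∀ d : ℕ, b ^ 2 = 8 * d + 1 →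
      (-1 : ℂ) ^ (((8 * u + b) ^ 2 - 1) / 8) = (-1) ^ d := by
    intro d hd
    have : ((8 * u + b) ^ 2 - 1) / 8 = 2 * (4 * u ^ 2 + u * b) + d := by
      have : (8 * u + b) ^ 2 = 8 * (2 * (4 * u ^ 2 + u * b) + d) + 1 := by
        calc (8 * u + b) ^ 2 = 64 * u ^ 2 + 16 * (u * b) + b ^ 2 := by ring
          _ = _ := by rw [hd]; ring
      rw [this]; omega
    rw [this, pow_add, pow_mul]; simp
  have hbo : b % 2 = 1 := by
    obtain ⟨z, hz⟩ := ha; omega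
  interval_cases b <;> simp at hbo
  · rw [key 0 rfl]; ring
  · rw [key 1 rfl]
    linear_combination (v^17 - v^13 + v^9 - v^5 + v + v ^ 3) * hv4 
  · rw [key 3 rfl]
    linear_combination (v + v ^ 7 * (v ^ 24 - v ^ 20 + v ^ 16 - v ^ 12 + v ^ 8 - v ^ 4 + 1)) * hv4
  · rw [key 6 rfl]
    linear_combination (v * (v ^ 4 - 1) *
      (v ^ 40 + v ^ 32 + v ^ 24 + v ^ 16 + v ^ 8 + 1)) * hv4

/-- A primitive `8s`-th root of unity `w` for which `√2 = w^s + w^(7s)`. -/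
theorem rc_root (s : ℕ) (hs : 0 < s) : ∃ w : ℂ, IsPrimitiveRoot w (8 * s) ∧
    (w ^ s) ^ 4 = -1 ∧ w ^ s + (w ^ s) ^ 7 = ((Real.sqrt 2 : ℝ) : ℂ) := by
  have hs' : (s : ℂ) ≠ 0 := by exact_mod_cast hs.ne'
  refine ⟨_, Complex.isPrimitiveRoot_exp (8 * s) (by omega), ?_⟩
  have h1 : Complex.exp (2 * Real.pi * Complex.I / ((8 * s : ℕ) : ℂ)) ^ s =
      ((Real.sqrt 2 : ℝ) : ℂ) / 2 * (1 + Complex.I) := by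
    rw [← Complex.exp_nat_mul]
    have : (s : ℂ) * (2 * Real.pi * Complex.I / ((8 * s : ℕ) : ℂ)) =
        ((Real.pi / 4 : ℝ) : ℂ) * Complex.I := by
      push_cast
      field_simp
      ring
    rw [this, Complex.exp_mul_I, ← Complex.ofReal_cos, ← Complex.ofReal_sin,
      Real.cos_pi_div_four, Real.sin_pi_div_four]
    push_cast
    ring
  have h2 : ((Real.sqrt 2 : ℝ) : ℂ) ^ 2 = 2 := by
    rw [← Complex.ofReal_pow, Real.sq_sqrt (by norm_num)]; norm_num
  have hI := Complex.I_sq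
  rw [h1]
  set x : ℂ := ((Real.sqrt 2 : ℝ) : ℂ)
  have hv2 : (x / 2 * (1 + Complex.I)) ^ 2 = Complex.I := by
    rw [mul_pow, div_pow, h2]
    linear_combination (1 / 2 : ℂ) * hI
  have hv4 : (x / 2 * (1 + Complex.I)) ^ 4 = -1 := by
    rw [show 4 = 2 * 2 from rfl, pow_mul, hv2, hI]
  refine ⟨hv4, ?_⟩
  rw [show 7 = 4 + 2 + 1 from rfl, pow_succ, pow_add, hv4, hv2]
  linear_combination (-x / 2) * hI

/-- Action of a Galois conjugation on the odd power sums. -/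
theorem rc_galois (r N : ℕ) (ζ : Fin N → ℂ) (s : ℕ) (hs : 0 < s) (hζs : ∀ i, ζ i ^ s = 1)
    (hrat : ∀ j : ℕ, ∃ c : ℚ,
      (∏ i, (Polynomial.X -
        Polynomial.C (((Real.sqrt ((2 : ℝ) ^ r) : ℝ) : ℂ) * ζ i))).coeff j = (c : ℂ))
    (k : ℕ) (hodd : Odd (k * r)) (a : ℕ) (ha : a.Coprime (8 * s)) :
    ∑ i, ζ i ^ k = (-1 : ℂ) ^ ((a ^ 2 - 1) / 8) * ∑ i, ζ i ^ (k * a) := by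
  have hq : ((Real.sqrt ((2 : ℝ) ^ r) : ℝ) : ℂ) = ((Real.sqrt 2 : ℝ) : ℂ) ^ r := by
    rw [← Complex.ofReal_pow]
    congr 1
    rw [Real.sqrt_eq_iff_mul_self_eq (by positivity) (by positivity), ← mul_pow,
      Real.mul_self_sqrt (by norm_num)]
  obtain ⟨c, hc⟩ := rc_psum_rat N _ hrat k
  obtain ⟨w, hw, hv4, hv⟩ := rc_root s hs
  have hw8 : IsPrimitiveRoot (w ^ 8) s := hw.pow (by omega) rfl
  have : NeZero s := ⟨hs.ne'⟩
  have hex : ∀ i, ∃ e : ℕ, (w ^ 8) ^ e = ζ i := fun i => by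
    obtain ⟨e, -, he⟩ := hw8.eq_pow_of_pow_eq_one (hζs i)
    exact ⟨e, he⟩
  choose e he using hex
  have haodd : Odd a := by
    have h2 : a.Coprime 2 := Nat.Coprime.coprime_dvd_right ⟨4 * s, by ring⟩ ha
    exact Nat.coprime_two_right.mp h2
  let f : Polynomial ℚ := (Polynomial.X ^ s + (Polynomial.X ^ s) ^ 7) ^ (k * r) *
    ∑ i, ((Polynomial.X ^ 8) ^ e i) ^ k
  have hf : ∀ z : ℂ, Polynomial.aeval z f = (z ^ s + (z ^ s) ^ 7) ^ (k * r) *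
      ∑ i, ((z ^ 8) ^ e i) ^ k := by
    intro z; simp [f]
  have h1 : Polynomial.aeval w f = (c : ℂ) := by
    rw [hf, hv, ← hc, hq]
    simp only [he, mul_pow, ← Finset.mul_sum]
    rw [← pow_mul, mul_comm k r]
  have h2 := rc_conj (8 * s) (by omega) w hw a ha f c h1
  rw [← h1, hf, hf, hv] at h2
  have g1 : (w ^ a) ^ s + ((w ^ a) ^ s) ^ 7 =
      (-1 : ℂ) ^ ((a ^ 2 - 1) / 8) * ((Real.sqrt 2 : ℝ) : ℂ) := by
    rw [← rc_gauss (w ^ s) hv4 hv a haodd]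
    ring
  have g2 : ∀ i, (((w ^ a) ^ 8) ^ e i) ^ k = ζ i ^ (k * a) := by
    intro i
    rw [← he i]
    ring
  have hx : ((Real.sqrt 2 : ℝ) : ℂ) ^ (k * r) ≠ 0 := by
    apply pow_ne_zero
    exact_mod_cast (Real.sqrt_pos.mpr (by norm_num : (0 : ℝ) < 2)).ne'
  have hsgn : ((-1 : ℂ) ^ ((a ^ 2 - 1) / 8)) ^ (k * r) = (-1 : ℂ) ^ ((a ^ 2 - 1) / 8) := by
    rw [← pow_mul, mul_comm, pow_mul, hodd.neg_one_pow]
  simp only [he, g1, g2, mul_pow, hsgn] at h2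
  apply mul_left_cancel₀ hx
  rw [← h2]
  ring

theorem rc_sign (a t : ℕ) (ht : Odd t) (h : a ≡ t [MOD 8]) :
    (-1 : ℂ) ^ ((a ^ 2 - 1) / 8) = (-1 : ℂ) ^ ((t ^ 2 - 1) / 8) := by
  obtain ⟨w, -, hv4, hv⟩ := rc_root 1 one_pos
  have ha : Odd a := by
    unfold Nat.ModEq at h
    rw [Nat.odd_iff] at *
    omega
  have h1 := rc_gauss _ hv4 hv a ha
  have h2 := rc_gauss _ hv4 hv t ht
  have h8 : (w ^ 1) ^ 8 = 1 := by
    rw [show 8 = 4 * 2 from rfl, pow_mul, hv4]; norm_num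
  have e1 : (w ^ 1) ^ a = (w ^ 1) ^ t := pow_eq_pow_of_modEq h h8
  have e2 : (w ^ 1) ^ (7 * a) = (w ^ 1) ^ (7 * t) := pow_eq_pow_of_modEq (h.mul_left 7) h8
  rw [e1, e2, h2] at h1
  have hx : ((Real.sqrt 2 : ℝ) : ℂ) ≠ 0 := by
    exact_mod_cast (Real.sqrt_pos.mpr (by norm_num : (0 : ℝ) < 2)).ne'
  exact (mul_right_cancel₀ hx h1).symm

/-- Lifting residues coprime to `L` to integers coprime to a multiple of `L`. -/
theorem rc_lift (L M t : ℕ) (hM : 0 < M) (hLM : L ∣ M) (ht : t.Coprime L) :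
    ∃ a : ℕ, a.Coprime M ∧ a ≡ t [MOD L] := by
  have : NeZero M := ⟨hM.ne'⟩
  obtain ⟨u, hu⟩ := ZMod.unitsMap_surjective hLM (ZMod.unitOfCoprime t ht)
  refine ⟨(u : ZMod M).val, ZMod.val_coe_unit_coprime u, ?_⟩
  rw [← ZMod.natCast_eq_natCast_iff]
  have h := congrArg (fun z : (ZMod L)ˣ => (z : ZMod L)) hu
  simp only [ZMod.unitsMap_def, Units.coe_map, ZMod.coe_unitOfCoprime] at h
  rw [← h]
  simp


/-- Reduction theorem for supersingular curves in characteristic `2`, case `m·r` odd: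
with `q = 2^r`, `ζ_1, …, ζ_{2g}` roots of unity of period `s` such that `∏ (X - √q·ζ_i)`
has rational coefficients, `S_k = -q^{k/2}·∑ ζ_i^k`, `n > 0`, `m = gcd(n,s)`, `t = n/m`
and `m·r` odd, we have `S_n = q^{(n-m)/2}·S_m·(-1)^{(t²-1)/8}`. -/
theorem reduction_char_two (r g : ℕ) (hr : 1 ≤ r) (hg : 1 ≤ g)
    (ζ : Fin (2 * g) → ℂ) (s : ℕ) (hs : 0 < s) (hζs : ∀ i, ζ i ^ s = 1)
    (hleast : ∀ s' : ℕ, 0 < s' → (∀ i, ζ i ^ s' = 1) → s ≤ s')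
    (hrat : ∀ j : ℕ, ∃ c : ℚ,
      (∏ i, (Polynomial.X -
        Polynomial.C (((Real.sqrt ((2 : ℝ) ^ r) : ℝ) : ℂ) * ζ i))).coeff j = (c : ℂ))
    (S : ℕ → ℂ)
    (hS : ∀ k : ℕ, S k = -((Real.sqrt ((2 : ℝ) ^ r) : ℝ) : ℂ) ^ k * ∑ i, ζ i ^ k)
    (n : ℕ) (hn : 0 < n) (m t : ℕ) (hm : m = Nat.gcd n s) (ht : t = n / m)
    (hodd : Odd (m * r)) :
    S n = ((Real.sqrt ((2 : ℝ) ^ r) : ℝ) : ℂ) ^ (n - m) * S m *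
      (-1 : ℂ) ^ ((t ^ 2 - 1) / 8) := by
  -- the period is even
  have hs2 : Even s := by
    by_contra hso
    rw [Nat.not_even_iff_odd] at hso
    have hrodd : Odd r := (Nat.odd_mul.mp hodd).2
    have hcop : (1 + 4 * s).Coprime (8 * s) := by
      apply Nat.Coprime.mul_right
      · rw [show 8 = 2 ^ 3 from rfl]
        apply Nat.Coprime.pow_right
        rw [Nat.coprime_two_right, Nat.odd_iff]
        omega
      · simp
    have h := rc_galois r (2 * g) ζ s hs hζs hrat s (hso.mul hrodd) (1 + 4 * s) hcop
    rw [rc_sign (1 + 4 * s) 5 (by decide) (by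
      rw [Nat.odd_iff] at hso
      unfold Nat.ModEq
      omega)] at h
    simp only [pow_mul, hζs, one_pow] at h
    norm_num at h
    have hg' : (g : ℂ) ≠ 0 := by exact_mod_cast (by omega : g ≠ 0)
    apply hg'
    linear_combination (1 / 4 : ℂ) * h
  have hmodd : Odd m := (Nat.odd_mul.mp hodd).1
  have hmpos : 0 < m := hmodd.pos
  have hmn : m ∣ n := hm ▸ Nat.gcd_dvd_left n s
  have hms : m ∣ s := hm ▸ Nat.gcd_dvd_right n s
  have hnt : m * t = n := by rw [ht]; exact Nat.mul_div_cancel' hmn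
  have hnodd : Odd n := by
    by_contra hne
    rw [Nat.not_odd_iff_even] at hne
    have h2 : 2 ∣ m := hm ▸ Nat.dvd_gcd hne.two_dvd hs2.two_dvd
    rw [Nat.odd_iff] at hmodd
    omega
  have htodd : Odd t := (Nat.odd_mul.mp (hnt ▸ hnodd)).2
  have hcop : t.Coprime (s / m) := by
    have := Nat.coprime_div_gcd_div_gcd (m := n) (n := s) (hm ▸ hmpos)
    rwa [← hm, ← ht] at this
  have hcop8 : t.Coprime 8 := by
    rw [show 8 = 2 ^ 3 from rfl]
    exact Nat.Coprime.pow_right _ (Nat.coprime_two_right.mpr htodd)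
  have hL : Nat.lcm 8 (s / m) ∣ 8 * s :=
    Nat.lcm_dvd ⟨s, rfl⟩ ((Nat.div_dvd_of_dvd hms).mul_left 8)
  have hcopL : t.Coprime (Nat.lcm 8 (s / m)) :=
    Nat.Coprime.coprime_dvd_right (Nat.lcm_dvd_mul _ _) (hcop8.mul_right hcop)
  obtain ⟨a, ha, hat⟩ := rc_lift _ (8 * s) t (by omega) hL hcopL
  have h := rc_galois r (2 * g) ζ s hs hζs hrat m hodd a ha
  rw [rc_sign a t htodd (hat.of_dvd (Nat.dvd_lcm_left _ _))] at h
  have hpow : ∀ i, ζ i ^ (m * a) = ζ i ^ n := by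
    intro i
    rw [← hnt, pow_mul, pow_mul]
    apply pow_eq_pow_of_modEq (hat.of_dvd (Nat.dvd_lcm_right _ _))
    rw [← pow_mul, Nat.mul_div_cancel' hms, hζs]
  simp only [hpow] at h
  have hsq : (-1 : ℂ) ^ ((t ^ 2 - 1) / 8) * (-1 : ℂ) ^ ((t ^ 2 - 1) / 8) = 1 := by
    rw [← mul_pow]; simp
  have hnm : n = (n - m) + m := (Nat.sub_add_cancel (Nat.le_of_dvd hn hmn)).symm
  have hq := pow_add ((Real.sqrt ((2 : ℝ) ^ r) : ℝ) : ℂ) (n - m) m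
  rw [← hnm] at hq
  rw [hS n, hS m, hq, h]
  linear_combination (((Real.sqrt ((2 : ℝ) ^ r) : ℝ) : ℂ) ^ (n - m) *
    ((Real.sqrt ((2 : ℝ) ^ r) : ℝ) : ℂ) ^ m * ∑ i, ζ i ^ n) * hsq
end

section
/- Let p be a prime, r ≥ 1, q = p^r, and g ≥ 1. Let ζ_1, …, ζ_{2g} and ζ'_1, …, ζ'_{2g} be two families of roots of unity in ℂ such that both polynomials L(T) = ∏_{i=1}^{2g}(1 - √q·ζ_i·T) = ∑_{i=0}^{2g} c_i T^i and L'(T) = ∏_{i=1}^{2g}(1 - √q·ζ'_i·T) = ∑_{i=0}^{2g} c'_i T^i have rational coefficients, and such that both families have the same period s (the least positive integer s with ζ_i^s = 1 for all i, respectively ζ'_i^s = 1 for all i). Let l be an integer with 1 < l ≤ g such that l does not divide s. If c_j = c'_j for all 1 ≤ j < l, then c_l = c'_l. -/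
theorem aux_coeff {n : ℕ} (b : Fin n → ℂ) (j : ℕ) :
    (∏ i, (1 - Polynomial.C (b i) * Polynomial.X)).coeff j =
      MvPolynomial.aeval (fun i => -b i) (MvPolynomial.esymm (Fin n) ℂ j) := by
  have h1 : ∀ i, (1 - Polynomial.C (b i) * Polynomial.X) =
      1 + Polynomial.C (-b i) * Polynomial.X := by
    intro i
    rw [Polynomial.C_neg]
    ring
  simp_rw [h1]
  rw [Finset.prod_one_add, Polynomial.finsetSum_coeff]
  simp_rw [Finset.prod_mul_distrib, Finset.prod_const, ← map_prod, Polynomial.coeff_C_mul_X_pow]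
  rw [MvPolynomial.esymm, map_sum, ← Finset.sum_filter]
  have h2 : (Finset.univ : Finset (Fin n)).powerset.filter (fun t => j = t.card) =
      Finset.powersetCard j Finset.univ := by
    ext t
    simp [Finset.mem_powersetCard, eq_comm]
  rw [h2]
  refine Finset.sum_congr rfl fun t _ => ?_
  simp

theorem aux_newton {n : ℕ} (a b : Fin n → ℂ) (l : ℕ)
    (h : ∀ j, j < l → MvPolynomial.aeval a (MvPolynomial.esymm (Fin n) ℂ j) =
      MvPolynomial.aeval b (MvPolynomial.esymm (Fin n) ℂ j)) :
    ∀ k, 0 < k → k < l → ∑ i, a i ^ k = ∑ i, b i ^ k := by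
  intro k
  induction k using Nat.strong_induction_on with
  | _ k ih =>
    intro hk hkl
    have hN := MvPolynomial.psum_eq_mul_esymm_sub_sum (Fin n) ℂ k hk
    have ha := congrArg (MvPolynomial.aeval a) hN
    have hb := congrArg (MvPolynomial.aeval b) hN
    simp only [MvPolynomial.psum, map_sub, map_mul, map_sum, map_pow, map_neg, map_one,
      map_natCast, MvPolynomial.aeval_X] at ha hb
    rw [ha, hb, h k hkl]
    congr 1
    refine Finset.sum_congr rfl fun x hx => ?_
    simp only [Finset.mem_filter, Set.mem_Ioo] at hx
    have hx1 : x.1 + x.2 = k := Finset.HasAntidiagonal.mem_antidiagonal.mp hx.1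
    rw [h x.1 (by omega), ih x.2 (by omega) (by omega) (by omega)]

theorem aux_last {n : ℕ} (a b : Fin n → ℂ) (l : ℕ) (hl : 0 < l)
    (h : ∀ j, j < l → MvPolynomial.aeval a (MvPolynomial.esymm (Fin n) ℂ j) =
      MvPolynomial.aeval b (MvPolynomial.esymm (Fin n) ℂ j))
    (hp : ∑ i, a i ^ l = ∑ i, b i ^ l) :
    MvPolynomial.aeval a (MvPolynomial.esymm (Fin n) ℂ l) =
      MvPolynomial.aeval b (MvPolynomial.esymm (Fin n) ℂ l) := by
  have hN := MvPolynomial.mul_esymm_eq_sum (Fin n) ℂ l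
  have ha := congrArg (MvPolynomial.aeval a) hN
  have hb := congrArg (MvPolynomial.aeval b) hN
  simp only [MvPolynomial.psum, map_mul, map_sum, map_pow, map_neg, map_one,
    map_natCast, MvPolynomial.aeval_X] at ha hb
  have hl' : (l : ℂ) ≠ 0 := by exact_mod_cast hl.ne'
  apply mul_left_cancel₀ hl'
  rw [ha, hb]
  congr 1
  refine Finset.sum_congr rfl fun x hx => ?_
  simp only [Finset.mem_filter] at hx
  have hx1 : x.1 + x.2 = l := Finset.HasAntidiagonal.mem_antidiagonal.mp hx.1
  rw [h x.1 (by omega)]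
  congr 1
  rcases Nat.eq_or_lt_of_le (show x.2 ≤ l by omega) with e | e
  · rw [e, hp]
  · exact aux_newton a b l h x.2 (by omega) e

theorem aux_galois_s16 {n : ℕ} (ζ ζ' : Fin n → ℂ) (s d t : ℕ) (hs : 0 < s) (ht : t.Coprime s)
    (hζ : ∀ i, ζ i ^ s = 1) (hζ' : ∀ i, ζ' i ^ s = 1)
    (h : ∑ i, ζ i ^ d = ∑ i, ζ' i ^ d) :
    ∑ i, ζ i ^ (t * d) = ∑ i, ζ' i ^ (t * d) := by
  haveI : NeZero s := ⟨hs.ne'⟩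
  have hη := Complex.isPrimitiveRoot_exp s hs.ne'
  generalize Complex.exp (2 * Real.pi * Complex.I / s) = η at hη
  choose e _ he using fun i => hη.eq_pow_of_pow_eq_one (hζ i)
  choose e' _ he' using fun i => hη.eq_pow_of_pow_eq_one (hζ' i)
  let F : Polynomial ℚ := ∑ i, Polynomial.X ^ (e i * d) - ∑ i, Polynomial.X ^ (e' i * d)
  have hF : ∀ x : ℂ, Polynomial.aeval x F = ∑ i, x ^ (e i * d) - ∑ i, x ^ (e' i * d) := by
    intro x
    simp [F]
  have h0 : Polynomial.aeval η F = 0 := by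
    rw [hF, sub_eq_zero]
    simp_rw [pow_mul, he, he']
    exact h
  have hdvd := minpoly.dvd ℚ η h0
  rw [← Polynomial.cyclotomic_eq_minpoly_rat hη hs] at hdvd
  rw [Polynomial.cyclotomic_eq_minpoly_rat (hη.pow_of_coprime t ht) hs] at hdvd
  have h1 : Polynomial.aeval (η ^ t) F = 0 := by
    obtain ⟨G, hG⟩ := hdvd
    rw [hG, map_mul, minpoly.aeval, zero_mul]
  rw [hF, sub_eq_zero] at h1
  have key : ∀ m : ℕ, (η ^ t) ^ (m * d) = (η ^ m) ^ (t * d) := by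
    intro m
    rw [← pow_mul, ← pow_mul]
    congr 1
    ring
  simp_rw [key, he, he'] at h1
  exact h1

/-- If two degree-`2g` "supersingular L-polynomials" `L(T) = ∏ (1 - √q·ζ_i·T)` and
`L'(T) = ∏ (1 - √q·ζ'_i·T)` over `ℚ` have the same period `s`, and `1 < l ≤ g` with
`l ∤ s`, then agreement of the coefficients `c_j = c'_j` for `1 ≤ j < l` forces
`c_l = c'_l`. -/
theorem coeff_determined (p r g s l : ℕ) (hp : p.Prime) (hr : 1 ≤ r) (hg : 1 ≤ g)
    (ζ ζ' : Fin (2 * g) → ℂ) (hs : 0 < s)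
    (hζs : ∀ i, ζ i ^ s = 1) (hζ's : ∀ i, ζ' i ^ s = 1)
    (hleast : ∀ s' : ℕ, 0 < s' → (∀ i, ζ i ^ s' = 1) → s ≤ s')
    (hleast' : ∀ s' : ℕ, 0 < s' → (∀ i, ζ' i ^ s' = 1) → s ≤ s')
    (hrat : ∀ j : ℕ, ∃ c : ℚ,
      (∏ i, (1 - Polynomial.C (((Real.sqrt ((p : ℝ) ^ r) : ℝ) : ℂ) * ζ i) *
        Polynomial.X)).coeff j = (c : ℂ))
    (hrat' : ∀ j : ℕ, ∃ c : ℚ,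
      (∏ i, (1 - Polynomial.C (((Real.sqrt ((p : ℝ) ^ r) : ℝ) : ℂ) * ζ' i) *
        Polynomial.X)).coeff j = (c : ℂ))
    (hl1 : 1 < l) (hlg : l ≤ g) (hls : ¬ l ∣ s)
    (hcoef : ∀ j : ℕ, 1 ≤ j → j < l →
      (∏ i, (1 - Polynomial.C (((Real.sqrt ((p : ℝ) ^ r) : ℝ) : ℂ) * ζ i) *
        Polynomial.X)).coeff j =
      (∏ i, (1 - Polynomial.C (((Real.sqrt ((p : ℝ) ^ r) : ℝ) : ℂ) * ζ' i) *
        Polynomial.X)).coeff j) :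
    (∏ i, (1 - Polynomial.C (((Real.sqrt ((p : ℝ) ^ r) : ℝ) : ℂ) * ζ i) *
      Polynomial.X)).coeff l =
    (∏ i, (1 - Polynomial.C (((Real.sqrt ((p : ℝ) ^ r) : ℝ) : ℂ) * ζ' i) *
      Polynomial.X)).coeff l := by
  have hq : ((Real.sqrt ((p : ℝ) ^ r) : ℝ) : ℂ) ≠ 0 := by
    have : (0 : ℝ) < (p : ℝ) ^ r := pow_pos (by exact_mod_cast hp.pos) r
    exact_mod_cast (Real.sqrt_pos.mpr this).ne'
  generalize ((Real.sqrt ((p : ℝ) ^ r) : ℝ) : ℂ) = Q at *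
  simp only [aux_coeff] at hcoef ⊢
  have hall : ∀ j, j < l →
      MvPolynomial.aeval (fun i => -(Q * ζ i)) (MvPolynomial.esymm (Fin (2 * g)) ℂ j) =
      MvPolynomial.aeval (fun i => -(Q * ζ' i)) (MvPolynomial.esymm (Fin (2 * g)) ℂ j) := by
    intro j hj
    rcases Nat.eq_zero_or_pos j with rfl | h0
    · simp
    · exact hcoef j h0 hj
  have hpow : ∀ (z : Fin (2 * g) → ℂ) (k : ℕ),
      ∑ i, (-(Q * z i)) ^ k = (-Q) ^ k * ∑ i, z i ^ k := by
    intro z k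
    rw [Finset.mul_sum]
    refine Finset.sum_congr rfl fun i _ => ?_
    rw [← neg_mul, mul_pow]
  refine aux_last _ _ l (by omega) hall ?_
  rw [hpow, hpow]
  congr 1
  haveI : NeZero s := ⟨hs.ne'⟩
  obtain ⟨d, hds, u, hu, hlu⟩ := ZMod.eq_unit_mul_divisor (N := s) (l : ZMod s)
  have hut : ((u.val : ℕ) : ZMod s) = u := ZMod.natCast_zmod_val u
  generalize u.val = t at hut
  subst hut
  have ht : t.Coprime s := (ZMod.isUnit_iff_coprime t s).mp hu
  have hmod : l ≡ t * d [MOD s] := by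
    rw [← ZMod.natCast_eq_natCast_iff]
    push_cast
    exact hlu
  have hdl : d ∣ l := (hmod.dvd_iff hds).mpr (Dvd.intro_left t rfl)
  have hdlt : d < l := lt_of_le_of_ne (Nat.le_of_dvd (by omega) hdl) (by rintro rfl; exact hls hds)
  have hd0 : 0 < d := Nat.pos_of_dvd_of_pos hds hs
  have hd := aux_newton _ _ l hall d hd0 hdlt
  rw [hpow, hpow] at hd
  have hd' := mul_left_cancel₀ (pow_ne_zero d (neg_ne_zero.mpr hq)) hd
  have hfin := aux_galois_s16 ζ ζ' s d t hs ht hζs hζ's hd'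
  have hred : ∀ z : ℂ, z ^ s = 1 → z ^ l = z ^ (t * d) := by
    intro z hz
    rw [pow_eq_pow_mod l hz, pow_eq_pow_mod (t * d) hz, hmod]
  rw [Finset.sum_congr rfl fun i _ => hred _ (hζs i),
    Finset.sum_congr rfl fun i _ => hred _ (hζ's i)]
  exact hfin
end
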